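/- Let p, q be integers with p > 1 and q > 1, and set n = p+q. Let Ω be the 2n×2n block matrix [[0, I_n], [-I_n, 0]], let G = {A ∈ SL(2n, ℂ) : conj(A) = Ω⁻¹ A Ω}, where conj(A) denotes the entrywise complex conjugate (G is the group SU*(2n), the standard matrix realization of SL(n, ℍ) over the quaternions), let K = diag(I_p, -I_q, I_p, -I_q), and let H = {A ∈ G : A* K A = K} (the standard realization of the quaternionic unitary group Sp(p,q) inside SU*(2n)). Then there is no discrete subgroup Γ of G acting properly discontinuously and cocompactly on the homogeneous space G/H; that is, SL(p+q,ℍ)/Sp(p,q) admits no compact Clifford–Klein form. -/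

import Mathlib

/-!
The homogeneous space `SL(p+q,ℍ)/Sp(p,q)` (`p, q > 1`) admits no compact
Clifford–Klein form. Here `SL(n,ℍ)` is realized as the group
`SU*(2n) = {A ∈ SL(2n,ℂ) : conj(A) = Ω⁻¹ A Ω}`.
-/

open Matrix

set_option maxHeartbeats 1000000
set_option synthInstance.maxHeartbeats 1000000

noncomputable section

/-- The index type for `2n × 2n` block matrices with `n = p + q`. -/
abbrev QIdx (p q : ℕ) := (Fin p ⊕ Fin q) ⊕ (Fin p ⊕ Fin q)

/-- The standard symplectic matrix `Ω = [[0, I_n], [-I_n, 0]]`, `n = p + q`. -/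
def OmegaQ (p q : ℕ) : Matrix (QIdx p q) (QIdx p q) ℂ :=
  Matrix.fromBlocks 0 1 (-1) 0

/-- The entrywise complex conjugate of a complex matrix. -/
def matConj {ι : Type*} (M : Matrix ι ι ℂ) : Matrix ι ι ℂ :=
  M.map (starRingEnd ℂ)

theorem OmegaQ_neg_mul (p q : ℕ) : (-OmegaQ p q) * OmegaQ p q = 1 := by
  rw [OmegaQ, Matrix.fromBlocks_neg, Matrix.fromBlocks_multiply]
  rw [← Matrix.fromBlocks_one]
  simp
theorem OmegaQ_mul_neg (p q : ℕ) : OmegaQ p q * (-OmegaQ p q) = 1 := by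
  rw [OmegaQ, Matrix.fromBlocks_neg, Matrix.fromBlocks_multiply]
  rw [← Matrix.fromBlocks_one]
  simp

instance OmegaQ_invertible (p q : ℕ) : Invertible (OmegaQ p q) :=
  ⟨-OmegaQ p q, OmegaQ_neg_mul p q, OmegaQ_mul_neg p q⟩

theorem OmegaQ_inv_mul (p q : ℕ) : (OmegaQ p q)⁻¹ * OmegaQ p q = 1 := by
  rw [← Matrix.invOf_eq_nonsing_inv]
  exact invOf_mul_self _

theorem OmegaQ_mul_inv (p q : ℕ) : OmegaQ p q * (OmegaQ p q)⁻¹ = 1 := by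
  rw [← Matrix.invOf_eq_nonsing_inv]
  exact mul_invOf_self _

/-- The group `SU*(2n) ≅ SL(n, ℍ)` (`n = p + q`), realized as the subgroup of `GL(2n, ℂ)`
of matrices `A` with `det A = 1` and `conj(A) = Ω⁻¹ A Ω`, where `conj` is the entrywise
complex conjugate. -/
def SLH (p q : ℕ) : Subgroup (GL (QIdx p q) ℂ) where
  carrier := {A | A.val.det = 1 ∧ matConj A.val = (OmegaQ p q)⁻¹ * A.val * OmegaQ p q}
  one_mem' := by
    constructor
    · simp
    · show matConj 1 = (OmegaQ p q)⁻¹ * (1 : Matrix (QIdx p q) (QIdx p q) ℂ) * OmegaQ p q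
      rw [Matrix.mul_one, OmegaQ_inv_mul, matConj, Matrix.map_one] <;> simp
  mul_mem' := by
    rintro A B ⟨hA1, hA2⟩ ⟨hB1, hB2⟩
    constructor
    · rw [Units.val_mul, det_mul, hA1, hB1, mul_one]
    · rw [Units.val_mul]
      show (A.val * B.val).map (starRingEnd ℂ) = _
      rw [Matrix.map_mul]
      have hA2' : A.val.map (starRingEnd ℂ) = (OmegaQ p q)⁻¹ * A.val * OmegaQ p q := hA2
      have hB2' : B.val.map (starRingEnd ℂ) = (OmegaQ p q)⁻¹ * B.val * OmegaQ p q := hB2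
      rw [hA2', hB2']
      calc ((OmegaQ p q)⁻¹ * A.val * OmegaQ p q) * ((OmegaQ p q)⁻¹ * B.val * OmegaQ p q)
          = (OmegaQ p q)⁻¹ * A.val * ((OmegaQ p q * (OmegaQ p q)⁻¹) * (B.val * OmegaQ p q)) := by
            simp only [Matrix.mul_assoc]
        _ = (OmegaQ p q)⁻¹ * (A.val * B.val) * OmegaQ p q := by
            rw [OmegaQ_mul_inv, Matrix.one_mul]
            simp only [Matrix.mul_assoc]
  inv_mem' := by
    rintro A ⟨hA1, hA2⟩
    constructor
    · have h := congrArg Matrix.det (Units.mul_inv A)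
      rw [det_mul, hA1, one_mul] at h
      simpa using h
    · have hAinv : A.val * (A⁻¹).val = 1 := Units.mul_inv A
      have hM : A.val.map (starRingEnd ℂ) = (OmegaQ p q)⁻¹ * A.val * OmegaQ p q := hA2
      have hMN : A.val.map (starRingEnd ℂ) * (A⁻¹).val.map (starRingEnd ℂ) = 1 := by
        rw [← Matrix.map_mul, hAinv, Matrix.map_one] <;> simp
      set X : Matrix (QIdx p q) (QIdx p q) ℂ := (OmegaQ p q)⁻¹ * (A⁻¹).val * OmegaQ p q with hX
      have hXM : X * A.val.map (starRingEnd ℂ) = 1 := by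
        rw [hM, hX]
        calc ((OmegaQ p q)⁻¹ * (A⁻¹).val * OmegaQ p q) *
              ((OmegaQ p q)⁻¹ * A.val * OmegaQ p q)
            = (OmegaQ p q)⁻¹ * (A⁻¹).val *
                ((OmegaQ p q * (OmegaQ p q)⁻¹) * (A.val * OmegaQ p q)) := by
              simp only [Matrix.mul_assoc]
          _ = (OmegaQ p q)⁻¹ * ((A⁻¹).val * A.val) * OmegaQ p q := by
              rw [OmegaQ_mul_inv, Matrix.one_mul]
              simp only [Matrix.mul_assoc]
          _ = 1 := by rw [Units.inv_mul, Matrix.mul_one, OmegaQ_inv_mul]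
      show (A⁻¹).val.map (starRingEnd ℂ) = X
      calc (A⁻¹).val.map (starRingEnd ℂ)
          = (X * A.val.map (starRingEnd ℂ)) * (A⁻¹).val.map (starRingEnd ℂ) := by
            rw [hXM, Matrix.one_mul]
        _ = X * (A.val.map (starRingEnd ℂ) * (A⁻¹).val.map (starRingEnd ℂ)) := by
            rw [Matrix.mul_assoc]
        _ = X := by rw [hMN, Matrix.mul_one]

/-- The signature matrix `K = diag(I_p, -I_q, I_p, -I_q)`. -/
def KQ (p q : ℕ) : Matrix (QIdx p q) (QIdx p q) ℂ :=
  Matrix.diagonal (Sum.elim (Sum.elim (fun _ => 1) (fun _ => -1))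
    (Sum.elim (fun _ => 1) (fun _ => -1)))

/-- The quaternionic unitary group `Sp(p,q)`, realized as the subgroup of `SU*(2n) = SL(n,ℍ)`
(`n = p + q`) of matrices `A` with `A* K A = K`, where `A*` is the conjugate transpose and
`K = diag(I_p, -I_q, I_p, -I_q)`. -/
def SpPQinSLH (p q : ℕ) : Subgroup ↥(SLH p q) where
  carrier := {A | A.val.valᴴ * KQ p q * A.val.val = KQ p q}
  one_mem' := by
    show (1 : Matrix (QIdx p q) (QIdx p q) ℂ)ᴴ * KQ p q * 1 = KQ p q
    simp
  mul_mem' := by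
    intro A B hA hB
    show (A * B).val.valᴴ * KQ p q * (A * B).val.val = KQ p q
    have h : (A * B).val.val = A.val.val * B.val.val := rfl
    have key : (A.val.val * B.val.val)ᴴ * KQ p q * (A.val.val * B.val.val) =
        B.val.valᴴ * (A.val.valᴴ * KQ p q * A.val.val) * B.val.val := by
      rw [conjTranspose_mul]
      simp only [Matrix.mul_assoc]
    rw [h, key, hA]
    exact hB
  inv_mem' := by
    intro A hA
    show (A⁻¹).val.valᴴ * KQ p q * (A⁻¹).val.val = KQ p q
    have hAinv : A.val.val * (A⁻¹).val.val = 1 := by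
      have h : (A⁻¹).val = (A.val)⁻¹ := rfl
      rw [h]; exact Units.mul_inv A.val
    calc (A⁻¹).val.valᴴ * KQ p q * (A⁻¹).val.val
        = (A⁻¹).val.valᴴ * (A.val.valᴴ * KQ p q * A.val.val) * (A⁻¹).val.val := by rw [hA]
      _ = (A.val.val * (A⁻¹).val.val)ᴴ * KQ p q * (A.val.val * (A⁻¹).val.val) := by
          rw [conjTranspose_mul]
          simp only [Matrix.mul_assoc]
      _ = KQ p q := by rw [hAinv]; simp

section Stokes
open scoped Topology

theorem integral_faces_eq_of_extDeriv_eq_zero {N : ℕ}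
    (τ : (Fin (N + 1) → ℝ) → (Fin (N + 1) → ℝ) [⋀^Fin N]→L[ℝ] ℝ) (hτ : Differentiable ℝ τ)
    (hclosed : ∀ z, extDeriv τ z = 0) (R : ℝ) (hR : 0 ≤ R)
    (hsupp : ∀ z, R ≤ ‖Fin.tail z‖ → τ z = 0) :
    ∫ x in Set.Icc (fun _ : Fin N => -R) (fun _ => R),
        τ (Fin.cons 1 x) (fun j => Pi.single j.succ 1) =
      ∫ x in Set.Icc (fun _ : Fin N => -R) (fun _ => R),
        τ (Fin.cons 0 x) (fun j => Pi.single j.succ 1) := by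
  set e : Fin (N + 1) → (Fin (N + 1) → ℝ) := fun i => Pi.single i 1 with he
  set f : Fin (N + 1) → (Fin (N + 1) → ℝ) → ℝ := fun i z => (-1 : ℝ) ^ i.val • τ z (i.removeNth e)
    with hf
  have hev : ∀ i : Fin (N + 1), Differentiable ℝ (fun z => τ z (i.removeNth e)) := fun i : Fin (N + 1) =>
    (ContinuousAlternatingMap.apply ℝ (Fin (N + 1) → ℝ) ℝ (i.removeNth e)).differentiable.comp hτ
  have hfD : ∀ i, Differentiable ℝ (f i) := fun i => (hev i).const_smul ((-1 : ℝ) ^ i.val)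
  set a : Fin (N + 1) → ℝ := Fin.cons 0 (fun _ => -R) with ha
  set b : Fin (N + 1) → ℝ := Fin.cons 1 (fun _ => R) with hb
  have hle : a ≤ b := by
    intro i
    refine Fin.cases ?_ (fun j => ?_) i
    · simp [ha, hb]
    · simp only [ha, hb, Fin.cons_succ]; linarith
  have hdiv : ∀ z, ∑ i, fderiv ℝ (f i) z (Pi.single i 1) = 0 := by
    intro z
    have h := congrArg (fun ω => ω e) (hclosed z)
    simp only [extDeriv_apply (hτ z)] at h
    refine Eq.trans ?_ h
    refine Finset.sum_congr rfl fun i _ => ?_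
    simp only [hf, he]
    rw [fderiv_fun_const_smul (hev i z)]
    simp
    rfl
  have key := MeasureTheory.integral_divergence_of_hasFDerivAt_off_countable' a b hle f
    (fun i z => fderiv ℝ (f i) z) ∅ Set.countable_empty
    (fun i => (hfD i).continuous.continuousOn)
    (fun x _ i => (hfD i x).hasFDerivAt)
    (by simp only [hdiv]; exact MeasureTheory.integrableOn_zero)
  simp only [hdiv, MeasureTheory.integral_zero] at key
  rw [Fin.sum_univ_succ] at key
  have hside : ∀ (i : Fin N) (c : ℝ) (x : Fin N → ℝ), |c| = R →
      f i.succ (i.succ.insertNth c x) = 0 := by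
    intro i c x hc
    simp only [hf]
    rw [hsupp]
    · simp
    · have : Fin.tail (i.succ.insertNth c x : Fin (N + 1) → ℝ) i = c := by
        simp [Fin.tail]
      calc R = ‖Fin.tail (i.succ.insertNth c x : Fin (N + 1) → ℝ) i‖ := by rw [this, ← hc]; rfl
        _ ≤ _ := norm_le_pi_norm _ i
  have hz : ∀ i : Fin N, a i.succ = -R ∧ b i.succ = R := by
    intro i; simp [ha, hb]
  rw [Finset.sum_eq_zero] at key
  · have hfa : a ∘ Fin.succAbove 0 = fun _ => -R := by
      funext j; simp [ha]
    have hfb : b ∘ Fin.succAbove 0 = fun _ => R := by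
      funext j; simp [hb]
    rw [hfa, hfb] at key
    have h0 : ∀ z, f 0 z = τ z (fun j => Pi.single j.succ 1) := by
      intro z
      simp only [hf, he]
      simp
      rfl
    have ha0 : a 0 = 0 := rfl
    have hb0 : b 0 = 1 := rfl
    simp only [h0, ha0, hb0, Fin.insertNth_zero, add_zero] at key
    exact (sub_eq_zero.mp key.symm)
  · intro i _
    rw [(hz i).1, (hz i).2]
    simp only [hside i R _ (abs_of_nonneg hR), hside i (-R) _ (by rw [abs_neg, abs_of_nonneg hR])]
    simp

end Stokes

section DegreeIntegrand
open scoped Topology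

theorem extDeriv_top_degree_eq_zero {V : Type*} [NormedAddCommGroup V] [NormedSpace ℝ V]
    [FiniteDimensional ℝ V] {N : ℕ} (hN : Module.finrank ℝ V = N)
    (ω : V → V [⋀^Fin N]→L[ℝ] ℝ) (x : V) : extDeriv ω x = 0 := by
  ext v
  have h := AlternatingMap.map_linearDependent (extDeriv ω x).toAlternatingMap v (by
    intro hli
    have := hli.fintype_card_le_finrank
    simp [hN] at this)
  exact h

def basisDetCLM {V : Type*} [NormedAddCommGroup V] [NormedSpace ℝ V]
    [FiniteDimensional ℝ V] {N : ℕ} (b : Module.Basis (Fin N) ℝ V) : V [⋀^Fin N]→L[ℝ] ℝ :=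
  { b.det with
    cont := by
      change Continuous fun v : Fin N → V => b.det v
      simp only [Module.Basis.det_apply]
      refine Continuous.matrix_det ?_
      refine continuous_matrix fun i j => ?_
      simp only [Module.Basis.toMatrix_apply]
      exact (b.coord i).continuous_of_finiteDimensional.comp (continuous_apply j) }

theorem degree_integrand_eq_zero {V : Type*} [NormedAddCommGroup V] [NormedSpace ℝ V]
    [FiniteDimensional ℝ V] (Φ : ℝ × V → V) (hΦ : ContDiff ℝ 3 Φ)
    (g η : V → ℝ) (hg : ContDiff ℝ 3 g) (hη : ContDiff ℝ 3 η) (R : ℝ)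
    (hcpt : ∀ t x, R ≤ ‖x‖ → g (Φ (t, x)) = 0)
    (hloc : ∀ t x, (∀ᶠ y in 𝓝 x, η y = η x) ∨ (∀ᶠ z in 𝓝 (t, x), g (Φ z) = 0))
    (h1 : ∀ x, η x * g (Φ (1, x)) = 0) (s : ℝ) (hs : s ≠ 0)
    (hsign : ∀ x, 0 ≤ s * (η x * g (Φ (0, x)) * (fderiv ℝ (fun y => Φ (0, y)) x).det)) (x : V) :
    η x * g (Φ (0, x)) * (fderiv ℝ (fun y => Φ (0, y)) x).det = 0 := by
  set N := Module.finrank ℝ V with hN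
  let b : Module.Basis (Fin N) ℝ V := Module.finBasis ℝ V
  let e : V ≃L[ℝ] (Fin N → ℝ) := b.equivFunL
  let P : (Fin (N + 1) → ℝ) →L[ℝ] (ℝ × V) :=
    (ContinuousLinearMap.proj (R := ℝ) (φ := fun _ : Fin (N + 1) => ℝ) 0).prod
      ((e.symm : (Fin N → ℝ) →L[ℝ] V) ∘L
        (ContinuousLinearMap.pi fun i : Fin N => ContinuousLinearMap.proj i.succ))
  have hP : ∀ z, P z = (z 0, e.symm (Fin.tail z)) := fun z => rfl
  set Ψ : (Fin (N + 1) → ℝ) → V := fun z => Φ (P z) with hΨ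
  have hΨC : ContDiff ℝ 3 Ψ := hΦ.comp P.contDiff
  set ω : V → V [⋀^Fin N]→L[ℝ] ℝ := fun y => g y • basisDetCLM b with hω
  have hωC : ContDiff ℝ 3 ω := hg.smul contDiff_const
  set pull : (Fin (N + 1) → ℝ) → (Fin (N + 1) → ℝ) [⋀^Fin N]→L[ℝ] ℝ :=
    fun z => (ω (Ψ z)).compContinuousLinearMap (fderiv ℝ Ψ z) with hpull
  have hpull0 : ∀ z, extDeriv pull z = 0 := by
    intro z
    have := extDeriv_pullback (r := 3) (ω := ω) (f := Ψ) (x := z)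
      (hωC.differentiable (by norm_num) _) hΨC.contDiffAt (by simp; norm_num)
    rw [hpull, this, extDeriv_top_degree_eq_zero hN.symm]
    ext; simp
  set τ : (Fin (N + 1) → ℝ) → (Fin (N + 1) → ℝ) [⋀^Fin N]→L[ℝ] ℝ :=
    fun z => η (e.symm (Fin.tail z)) • pull z with hτ
  have hηD : Differentiable ℝ (fun z : Fin (N + 1) → ℝ => η (e.symm (Fin.tail z))) := by
    have : ContDiff ℝ 3 (fun z : Fin (N + 1) → ℝ => η (P z).2) :=
      hη.comp (contDiff_snd.comp P.contDiff)
    exact this.differentiable (by norm_num)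
  have hpullD : Differentiable ℝ pull := fun z =>
    DifferentiableAt.continuousAlternatingMapCompContinuousLinearMap
      ((hωC.comp hΨC).differentiable (by norm_num) z)
      ((hΨC.fderiv_right (m := 1) (by norm_num)).differentiable one_ne_zero z)
  have hτD : Differentiable ℝ τ := hηD.smul hpullD
  have hτ0 : ∀ z, extDeriv τ z = 0 := by
    intro z
    rcases hloc (P z).1 (P z).2 with h | h
    · have h2 : τ =ᶠ[𝓝 z] (η (P z).2) • pull := by
        have hc : Filter.Tendsto (fun z => (P z).2) (𝓝 z) (𝓝 (P z).2) :=
          ((continuous_snd.comp P.continuous).tendsto z)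
        filter_upwards [hc.eventually h] with w hw
        change η (P w).2 • pull w = _
        rw [hw]; rfl
      rw [h2.extDeriv_eq, extDeriv_smul, hpull0, smul_zero]
    · have h2 : τ =ᶠ[𝓝 z] (0 : ℝ) • pull := by
        have hc : Filter.Tendsto P (𝓝 z) (𝓝 ((P z).1, (P z).2)) := P.continuous.tendsto z
        filter_upwards [hc.eventually h] with w hw
        simp only [hτ, hpull, hω, hΨ]
        rw [hw]; ext; simp
      rw [h2.extDeriv_eq, extDeriv_smul, hpull0, smul_zero]
  have hgz : ∀ z v, g (Ψ z) = 0 → τ z v = 0 := by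
    intro z v h
    simp [hτ, hpull, hω, h]
  obtain ⟨R', hR'0, hR'⟩ : ∃ R' : ℝ, 0 ≤ R' ∧ ∀ v : Fin N → ℝ, R' ≤ ‖v‖ → R ≤ ‖e.symm v‖ := by
    refine ⟨‖(e : V →L[ℝ] (Fin N → ℝ))‖ * |R| + 1, by positivity, fun v hv => ?_⟩
    by_contra hlt
    push Not at hlt
    have h2 := (e : V →L[ℝ] (Fin N → ℝ)).le_opNorm (e.symm v)
    simp only [ContinuousLinearEquiv.coe_coe, e.apply_symm_apply] at h2
    have h3 := mul_le_mul_of_nonneg_left (hlt.le.trans (le_abs_self R))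
      (norm_nonneg (e : V →L[ℝ] (Fin N → ℝ)))
    linarith
  have hfaces := integral_faces_eq_of_extDeriv_eq_zero τ hτD hτ0 R' hR'0 (by
    intro z hz
    ext v
    exact hgz z v (hcpt _ _ (hR' _ hz)))
  have hcoef : ∀ t (y : Fin N → ℝ), τ (Fin.cons t y) (fun j => Pi.single j.succ 1) =
      η (e.symm y) * g (Φ (t, e.symm y)) * (fderiv ℝ (fun y => Φ (t, y)) (e.symm y)).det := by
    intro t y
    have hD : ∀ j : Fin N, fderiv ℝ Ψ (Fin.cons t y) (Pi.single j.succ 1) =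
        fderiv ℝ (fun y => Φ (t, y)) (e.symm y) (b j) := by
      intro j
      have hPy : P (Fin.cons t y) = (t, e.symm y) := rfl
      have hPj : P (Pi.single j.succ 1) = (0, b j) := by
        rw [hP]
        refine Prod.ext (by simp) ?_
        have : Fin.tail (Pi.single j.succ (1 : ℝ) : Fin (N + 1) → ℝ) = Pi.single j 1 := by
          funext i
          simp [Fin.tail, Pi.single_apply]
        simp only [this]
        refine e.injective ?_
        rw [e.apply_symm_apply]
        funext i
        simp [e, Module.Basis.equivFunL, Pi.single_apply, eq_comm]
      have hd : DifferentiableAt ℝ Φ (t, e.symm y) := hΦ.differentiable (by norm_num) _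
      have h5 : HasFDerivAt Ψ ((fderiv ℝ Φ (t, e.symm y)) ∘L P) (Fin.cons t y) :=
        HasFDerivAt.comp (g := Φ) (f := P) (Fin.cons t y)
          (by rw [hPy]; exact hd.hasFDerivAt) P.hasFDerivAt
      have h6 : HasFDerivAt (fun y => Φ (t, y))
          ((fderiv ℝ Φ (t, e.symm y)) ∘L ContinuousLinearMap.inr ℝ ℝ V) (e.symm y) :=
        HasFDerivAt.comp (g := Φ) (e.symm y) hd.hasFDerivAt (hasFDerivAt_prodMk_right t (e.symm y))
      rw [h5.fderiv, h6.fderiv]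
      simp [hPj]
    have h3 : basisDetCLM b (fun j => fderiv ℝ Ψ (Fin.cons t y) (Pi.single j.succ 1)) =
        (fderiv ℝ (fun y => Φ (t, y)) (e.symm y)).det := by
      simp only [hD]
      have := b.det_comp (fderiv ℝ (fun y => Φ (t, y)) (e.symm y) : V →ₗ[ℝ] V) b
      rw [b.det_self, mul_one] at this
      exact this
    have h4 : τ (Fin.cons t y) (fun j => Pi.single j.succ 1) = η (e.symm y) *
      (g (Φ (t, e.symm y)) *
        basisDetCLM b (fun j => fderiv ℝ Ψ (Fin.cons t y) (Pi.single j.succ 1))) := rfl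
    rw [h4, h3, mul_assoc]
  simp only [hcoef, h1, zero_mul, MeasureTheory.integral_zero] at hfaces
  set I : (Fin N → ℝ) → ℝ := fun y => s * (η (e.symm y) * g (Φ (0, e.symm y)) *
    (fderiv ℝ (fun y => Φ (0, y)) (e.symm y)).det) with hI
  have hIc : Continuous I := by
    have : I = fun y => s * τ (Fin.cons 0 y) (fun j => Pi.single j.succ 1) := by
      funext y; rw [hcoef]
    rw [this]
    have h7 : Continuous (fun y : Fin N → ℝ => (Fin.cons 0 y : Fin (N + 1) → ℝ)) :=
      continuous_const.finCons continuous_id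
    exact continuous_const.mul (((ContinuousAlternatingMap.apply ℝ (Fin (N + 1) → ℝ) ℝ
      (fun j : Fin N => (Pi.single j.succ 1 : Fin (N + 1) → ℝ))).continuous.comp
        hτD.continuous).comp h7)
  have hI0 : ∀ y, 0 ≤ I y := fun y => hsign _
  have hIsupp : ∀ y, y ∉ Set.Icc (fun _ : Fin N => -R') (fun _ => R') → I y = 0 := by
    intro y hy
    have hy' : R' ≤ ‖y‖ := by
      by_contra hlt
      push Not at hlt
      refine hy ⟨fun i => ?_, fun i => ?_⟩ <;>
      · have := abs_lt.mp ((norm_le_pi_norm y i).trans_lt hlt)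
        linarith [this.1, this.2]
    simp only [hI, hcpt _ _ (hR' y hy'), mul_zero, zero_mul]
  have hIint : ∫ y, I y = 0 := by
    rw [← MeasureTheory.setIntegral_eq_integral_of_forall_compl_eq_zero hIsupp]
    simp only [hI]
    rw [MeasureTheory.integral_const_mul, ← hfaces, mul_zero]
  by_contra hne
  have := Continuous.integral_pos_of_hasCompactSupport_nonneg_nonzero (μ := MeasureTheory.volume)
    hIc (HasCompactSupport.intro isCompact_Icc hIsupp) hI0 (x := e x) (by
      simp only [hI, e.symm_apply_apply]
      exact mul_ne_zero hs hne)
  linarith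

end DegreeIntegrand

section MatrixSqrt
open scoped MatrixOrder ComplexOrder

theorem Matrix.PosDef.exists_unique_sqrt {ι : Type*} [Fintype ι] [DecidableEq ι]
    {S : Matrix ι ι ℂ} (hS : S.PosDef) :
    ∃ R : Matrix ι ι ℂ, R.PosDef ∧ R * R = S ∧
      (∀ T : Matrix ι ι ℂ, T.PosSemidef → T * T = S → T = R) ∧
      ∀ M : Matrix ι ι ℂ, Commute S M → Commute R M := by
  have h0 := hS.posSemidef.nonneg
  have h1 : CFC.sqrt S * CFC.sqrt S = S := CFC.sqrt_mul_sqrt_self S h0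
  have h2 : (CFC.sqrt S).PosSemidef := nonneg_iff_posSemidef.mp (CFC.sqrt_nonneg S)
  refine ⟨CFC.sqrt S, ?_, h1, fun T hT hTS => ?_, fun M hM => hM.cfcₙ_nnreal _⟩
  · rw [h2.posDef_iff_det_ne_zero]
    intro h
    have := congrArg Matrix.det h1
    rw [det_mul, h, zero_mul] at this
    exact hS.det_pos.ne this
  · exact (CFC.sqrt_unique hTS hT.nonneg).symm

theorem Matrix.posDef_mul_conjTranspose_self_of_isUnit {ι : Type*} [Fintype ι] [DecidableEq ι]
    {A : Matrix ι ι ℂ} (hA : IsUnit A.det) : (A * Aᴴ).PosDef := by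
  rw [(posSemidef_self_mul_conjTranspose A).posDef_iff_det_ne_zero, det_mul, det_conjTranspose]
  exact mul_ne_zero hA.ne_zero (star_ne_zero.mpr hA.ne_zero)

end MatrixSqrt

section Quaternionic
open scoped ComplexOrder
variable {p q : ℕ}

theorem OmegaQ_mul_self (p q : ℕ) : OmegaQ p q * OmegaQ p q = -1 := by
  have := OmegaQ_neg_mul p q
  rw [neg_mul] at this
  rw [← this, neg_neg]

theorem OmegaQ_conjTranspose (p q : ℕ) : (OmegaQ p q)ᴴ = -OmegaQ p q := by
  simp [OmegaQ, Matrix.fromBlocks_conjTranspose, Matrix.fromBlocks_neg]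

/-- A complex matrix representing a quaternionic one. -/
def IsQuat (M : Matrix (QIdx p q) (QIdx p q) ℂ) : Prop :=
  OmegaQ p q * matConj M = M * OmegaQ p q

theorem isQuat_iff {M : Matrix (QIdx p q) (QIdx p q) ℂ} :
    IsQuat M ↔ matConj M = (OmegaQ p q)⁻¹ * M * OmegaQ p q := by
  unfold IsQuat
  constructor
  · intro h
    rw [Matrix.mul_assoc, ← h, ← Matrix.mul_assoc, OmegaQ_inv_mul, Matrix.one_mul]
  · intro h
    rw [h, ← Matrix.mul_assoc, ← Matrix.mul_assoc, OmegaQ_mul_inv, Matrix.one_mul]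

theorem matConj_mul {ι : Type*} [Fintype ι] (M N : Matrix ι ι ℂ) :
    matConj (M * N) = matConj M * matConj N := Matrix.map_mul

theorem matConj_one {ι : Type*} [DecidableEq ι] : matConj (1 : Matrix ι ι ℂ) = 1 := by
  rw [matConj, Matrix.map_one] <;> simp

theorem matConj_conjTranspose {ι : Type*} (M : Matrix ι ι ℂ) :
    matConj Mᴴ = (matConj M)ᴴ := by
  ext; simp [matConj]

theorem matConj_eq {ι : Type*} (M : Matrix ι ι ℂ) : matConj M = (Mᴴ)ᵀ := by
  ext; simp [matConj]

theorem matConj_det {ι : Type*} [Fintype ι] [DecidableEq ι] (M : Matrix ι ι ℂ) :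
    (matConj M).det = star M.det := by
  rw [matConj_eq, det_transpose, det_conjTranspose]

namespace IsQuat

variable {M N : Matrix (QIdx p q) (QIdx p q) ℂ}

theorem one : IsQuat (1 : Matrix (QIdx p q) (QIdx p q) ℂ) := by
  simp [IsQuat, matConj_one]

theorem mul (hM : IsQuat M) (hN : IsQuat N) : IsQuat (M * N) := by
  unfold IsQuat at *
  rw [matConj_mul, ← Matrix.mul_assoc, hM, Matrix.mul_assoc, hN, Matrix.mul_assoc]

theorem add (hM : IsQuat M) (hN : IsQuat N) : IsQuat (M + N) := by
  unfold IsQuat at *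
  have : matConj (M + N) = matConj M + matConj N := by ext; simp [matConj]
  rw [this, mul_add, add_mul, hM, hN]

theorem smul (c : ℝ) (hM : IsQuat M) : IsQuat (c • M) := by
  unfold IsQuat at *
  have : matConj (c • M) = c • matConj M := by ext; simp [matConj]
  rw [this, Matrix.mul_smul, hM, Matrix.smul_mul]

theorem zero : IsQuat (0 : Matrix (QIdx p q) (QIdx p q) ℂ) := by
  simpa using one.smul (0 : ℝ)

theorem neg (hM : IsQuat M) : IsQuat (-M) := by
  simpa using hM.smul (-1)

theorem sub (hM : IsQuat M) (hN : IsQuat N) : IsQuat (M - N) := by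
  rw [sub_eq_add_neg]; exact hM.add hN.neg

theorem conjTranspose (hM : IsQuat M) : IsQuat Mᴴ := by
  unfold IsQuat at *
  have h := congrArg (fun A => OmegaQ p q * Aᴴ * OmegaQ p q) hM
  simp only [conjTranspose_mul, OmegaQ_conjTranspose, matConj_conjTranspose] at h ⊢
  calc OmegaQ p q * (matConj M)ᴴ = - (OmegaQ p q * ((matConj M)ᴴ * (OmegaQ p q * OmegaQ p q))) := by
        rw [OmegaQ_mul_self]; simp
    _ = OmegaQ p q * ((matConj M)ᴴ * -OmegaQ p q) * OmegaQ p q := by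
        simp [Matrix.mul_assoc]
    _ = _ := by rw [h]
    _ = -(OmegaQ p q * OmegaQ p q) * (Mᴴ * OmegaQ p q) := by simp [Matrix.mul_assoc]
    _ = _ := by rw [OmegaQ_mul_self]; simp

theorem inv (hM : IsQuat M) (h : IsUnit M.det) : IsQuat M⁻¹ := by
  unfold IsQuat at *
  have h1 : matConj M * matConj M⁻¹ = 1 := by
    rw [← matConj_mul, Matrix.mul_nonsing_inv _ h, matConj_one]
  calc OmegaQ p q * matConj M⁻¹ = M⁻¹ * (M * OmegaQ p q) * matConj M⁻¹ := by
        rw [← Matrix.mul_assoc, Matrix.nonsing_inv_mul _ h, Matrix.one_mul]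
    _ = M⁻¹ * OmegaQ p q * (matConj M * matConj M⁻¹) := by
        rw [← hM]; simp only [Matrix.mul_assoc]
    _ = _ := by rw [h1, Matrix.mul_one]

theorem det_im (hM : IsQuat M) : star M.det = M.det := by
  rw [isQuat_iff] at hM
  rw [← matConj_det, hM, det_mul, det_mul, mul_comm, ← mul_assoc, ← det_mul, OmegaQ_mul_inv]
  simp

theorem of_sqrt {S R : Matrix (QIdx p q) (QIdx p q) ℂ} (hS : IsQuat S) (hR : R.PosSemidef)
    (hRS : R * R = S) (huniq : ∀ T, T.PosSemidef → T * T = S → T = R) : IsQuat R := by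
  have h1 : OmegaQ p q * matConj R * (OmegaQ p q)ᴴ = R := by
    apply huniq
    · refine PosSemidef.mul_mul_conjTranspose_same ?_ _
      rw [matConj_eq]
      exact hR.conjTranspose.transpose
    · rw [OmegaQ_conjTranspose]
      have : matConj R * matConj R = matConj S := by rw [← matConj_mul, hRS]
      calc OmegaQ p q * matConj R * -OmegaQ p q * (OmegaQ p q * matConj R * -OmegaQ p q)
          = (OmegaQ p q * matConj R) * (-OmegaQ p q * OmegaQ p q) * (matConj R * -OmegaQ p q) := by
            simp only [Matrix.mul_assoc]
        _ = OmegaQ p q * (matConj R * matConj R) * -OmegaQ p q := by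
            rw [OmegaQ_neg_mul, Matrix.mul_one]; simp only [Matrix.mul_assoc]
        _ = S := by rw [this, hS, Matrix.mul_assoc, OmegaQ_mul_neg, Matrix.mul_one]
  unfold IsQuat
  conv_rhs => rw [← h1]
  rw [OmegaQ_conjTranspose, Matrix.mul_assoc (_ * _), OmegaQ_neg_mul, Matrix.mul_one]

/-- Diagonal quaternionic matrices with real entries. -/
theorem diagonal (d : Fin p ⊕ Fin q → ℝ) :
    IsQuat (Matrix.diagonal (Sum.elim (fun i => (d i : ℂ)) (fun i => (d i : ℂ))) :
      Matrix (QIdx p q) (QIdx p q) ℂ) := by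
  unfold IsQuat
  ext (i | i) (j | j) <;> by_cases hij : i = j <;>
    simp [OmegaQ, matConj, hij]

end IsQuat

theorem KQ_eq : KQ p q = Matrix.diagonal (Sum.elim
    (fun i => ((Sum.elim (fun _ => 1) (fun _ => -1) : Fin p ⊕ Fin q → ℝ) i : ℂ))
    (fun i => ((Sum.elim (fun _ => 1) (fun _ => -1) : Fin p ⊕ Fin q → ℝ) i : ℂ))) := by
  unfold KQ
  congr 1
  funext i
  rcases i with (i | i) | (i | i) <;> simp

theorem KQ_isQuat : IsQuat (KQ p q) := by
  rw [KQ_eq]; exact IsQuat.diagonal _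

theorem KQ_mul_self : KQ p q * KQ p q = 1 := by
  unfold KQ
  rw [diagonal_mul_diagonal, ← diagonal_one]
  congr 1
  funext i
  rcases i with (i | i) | (i | i) <;> simp

theorem KQ_conjTranspose : (KQ p q)ᴴ = KQ p q := by
  unfold KQ
  rw [diagonal_conjTranspose]
  congr 1
  funext i
  rcases i with (i | i) | (i | i) <;> simp

end Quaternionic

section Orbit
open scoped ComplexOrder Topology
variable {p q : ℕ}

/-- Hermitian quaternionic matrices. -/
def hermQuat (p q : ℕ) : Submodule ℝ (Matrix (QIdx p q) (QIdx p q) ℂ) where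
  carrier := {X | Xᴴ = X ∧ IsQuat X}
  add_mem' := fun hX hY => ⟨by rw [conjTranspose_add, hX.1, hY.1], hX.2.add hY.2⟩
  zero_mem' := ⟨conjTranspose_zero, IsQuat.zero⟩
  smul_mem' := fun c X hX => ⟨by rw [conjTranspose_smul, hX.1]; simp, hX.2.smul c⟩

/-- The orbit of `K` under the maximal compact subgroup `Sp(n)`. -/
def unitaryOrbit (p q : ℕ) : Set (Matrix (QIdx p q) (QIdx p q) ℂ) :=
  {X | ∃ u : Matrix (QIdx p q) (QIdx p q) ℂ, u * uᴴ = 1 ∧ IsQuat u ∧ u.det = 1 ∧ u * KQ p q * uᴴ = X}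

theorem unitaryOrbit_mem_hermQuat {X : Matrix (QIdx p q) (QIdx p q) ℂ} (hX : X ∈ unitaryOrbit p q) :
    X ∈ hermQuat p q := by
  obtain ⟨u, -, h2, -, rfl⟩ := hX
  refine ⟨?_, (h2.mul KQ_isQuat).mul h2.conjTranspose⟩
  simp only [conjTranspose_mul, conjTranspose_conjTranspose, KQ_conjTranspose, Matrix.mul_assoc]

theorem unitaryOrbit_mul_self {X : Matrix (QIdx p q) (QIdx p q) ℂ} (hX : X ∈ unitaryOrbit p q) :
    X * X = 1 := by
  obtain ⟨u, h1, -, -, rfl⟩ := hX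
  have h1' : uᴴ * u = 1 := mul_eq_one_comm.mp h1
  calc u * KQ p q * uᴴ * (u * KQ p q * uᴴ) = u * KQ p q * (uᴴ * u) * (KQ p q * uᴴ) := by
        simp only [Matrix.mul_assoc]
    _ = u * (KQ p q * KQ p q) * uᴴ := by rw [h1', Matrix.mul_one]; simp only [Matrix.mul_assoc]
    _ = 1 := by rw [KQ_mul_self, Matrix.mul_one, h1]

theorem KQ_mem_unitaryOrbit : KQ p q ∈ unitaryOrbit p q :=
  ⟨1, by simp, IsQuat.one, by simp, by simp⟩

theorem trace_of_mem_unitaryOrbit {X : Matrix (QIdx p q) (QIdx p q) ℂ} (hX : X ∈ unitaryOrbit p q) :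
    X.trace = (KQ p q).trace := by
  obtain ⟨u, h1, -, -, rfl⟩ := hX
  have h1' : uᴴ * u = 1 := mul_eq_one_comm.mp h1
  rw [Matrix.trace_mul_comm, ← Matrix.mul_assoc, h1', Matrix.one_mul]

theorem eventually_mem_unitaryOrbit {X : Matrix (QIdx p q) (QIdx p q) ℂ}
    (hX : X ∈ unitaryOrbit p q) :
    ∀ᶠ Y in 𝓝 X, Y ∈ hermQuat p q → Y * Y = 1 → Y ∈ unitaryOrbit p q := by
  have hXX := unitaryOrbit_mul_self hX
  have hXh := unitaryOrbit_mem_hermQuat hX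
  have hcont : Continuous fun Y : Matrix (QIdx p q) (QIdx p q) ℂ => ((1 + Y * X).det).re := by
    fun_prop
  have hpos : 0 < ((1 + X * X).det).re := by
    have : (1 + X * X).det = ((2 : ℝ) ^ Fintype.card (QIdx p q) : ℝ) := by
      rw [hXX, ← two_smul ℂ (1 : Matrix (QIdx p q) (QIdx p q) ℂ), det_smul, det_one]
      simp
    rw [this, Complex.ofReal_re]
    positivity
  filter_upwards [hcont.continuousAt.eventually_const_lt hpos] with Y hY hYh hYY
  set v := 1 + Y * X with hv
  have hvq : IsQuat v := IsQuat.one.add (hYh.2.mul hXh.2)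
  have hvdet : IsUnit v.det := by
    rw [isUnit_iff_ne_zero]
    intro h
    rw [h] at hY; simp at hY
  have hYv : Y * v = v * X := by
    rw [hv, mul_add, add_mul, ← Matrix.mul_assoc, hYY, Matrix.mul_assoc, hXX]
    simp [add_comm]
  have hXv : X * vᴴ = vᴴ * Y := by
    have := congrArg Matrix.conjTranspose hYv
    rw [conjTranspose_mul, conjTranspose_mul, hXh.1, hYh.1] at this
    exact this.symm
  have hS := Matrix.posDef_mul_conjTranspose_self_of_isUnit hvdet
  obtain ⟨R, hR, hRS, hRu, hRc⟩ := hS.exists_unique_sqrt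
  have hRq : IsQuat R := (hvq.mul hvq.conjTranspose).of_sqrt hR.posSemidef hRS hRu
  have hRdet : IsUnit R.det := isUnit_iff_ne_zero.mpr hR.det_pos.ne'
  have hRY : R * Y = Y * R := by
    refine hRc Y ?_
    change v * vᴴ * Y = Y * (v * vᴴ)
    rw [Matrix.mul_assoc, ← hXv, ← Matrix.mul_assoc, ← Matrix.mul_assoc, hYv]
  have hRiY : R⁻¹ * Y = Y * R⁻¹ := by
    calc R⁻¹ * Y = R⁻¹ * (Y * R) * R⁻¹ := by
          rw [Matrix.mul_assoc, Matrix.mul_assoc, Matrix.mul_nonsing_inv _ hRdet, Matrix.mul_one]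
      _ = _ := by rw [← hRY, ← Matrix.mul_assoc, Matrix.nonsing_inv_mul _ hRdet, Matrix.one_mul]
  have hRih : (R⁻¹)ᴴ = R⁻¹ := by rw [conjTranspose_nonsing_inv, hR.isHermitian.eq]
  set w := R⁻¹ * v with hw
  have hwq : IsQuat w := (hRq.inv hRdet).mul hvq
  have hww : w * wᴴ = 1 := by
    rw [hw, conjTranspose_mul, hRih]
    calc R⁻¹ * v * (vᴴ * R⁻¹) = R⁻¹ * (v * vᴴ) * R⁻¹ := by simp only [Matrix.mul_assoc]
      _ = (R⁻¹ * R) * (R * R⁻¹) := by rw [← hRS]; simp only [Matrix.mul_assoc]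
      _ = 1 := by rw [Matrix.nonsing_inv_mul _ hRdet, Matrix.mul_nonsing_inv _ hRdet, one_mul]
  have hYw : Y * w = w * X := by
    rw [hw, ← Matrix.mul_assoc, ← hRiY, Matrix.mul_assoc, hYv, Matrix.mul_assoc]
  have hwdet : w.det = 1 := by
    have h1 : star w.det = w.det := hwq.det_im
    have h2 : w.det * w.det = 1 := by
      have := congrArg Matrix.det hww
      rwa [det_mul, det_conjTranspose, h1, det_one] at this
    have h3 : R.det * w.det = v.det := by
      rw [← det_mul, hw, ← Matrix.mul_assoc, Matrix.mul_nonsing_inv _ hRdet, Matrix.one_mul]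
    rcases mul_self_eq_one_iff.mp h2 with h | h
    · exact h
    · exfalso
      rw [h] at h3
      have h4 := (Complex.pos_iff.mp hR.det_pos).1
      rw [← h3] at hY
      simp at hY
      linarith
  obtain ⟨u, hu1, hu2, hu3, rfl⟩ := hX
  refine ⟨w * u, ?_, hwq.mul hu2, by rw [det_mul, hwdet, hu3, one_mul], ?_⟩
  · rw [conjTranspose_mul]
    calc w * u * (uᴴ * wᴴ) = w * (u * uᴴ) * wᴴ := by simp only [Matrix.mul_assoc]
      _ = 1 := by rw [hu1, Matrix.mul_one, hww]
  · rw [conjTranspose_mul]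
    calc w * u * KQ p q * (uᴴ * wᴴ) = w * (u * KQ p q * uᴴ) * wᴴ := by simp only [Matrix.mul_assoc]
      _ = Y := by rw [← hYw, Matrix.mul_assoc, hww, Matrix.mul_one]

theorem exists_stabilizer_mul_conjTranspose {g X : Matrix (QIdx p q) (QIdx p q) ℂ}
    (hgq : IsQuat g) (hg1 : g.det = 1) (hX : g * KQ p q * gᴴ = X) :
    ∃ h P : Matrix (QIdx p q) (QIdx p q) ℂ, IsQuat h ∧ h.det = 1 ∧ hᴴ * KQ p q * h = KQ p q ∧
      P.PosDef ∧ P * P = X * X ∧ (g * h) * (g * h)ᴴ = P := by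
  have hgu : IsUnit g.det := by rw [hg1]; exact isUnit_one
  have hXh : Xᴴ = X := by
    rw [← hX]
    simp only [conjTranspose_mul, conjTranspose_conjTranspose, KQ_conjTranspose, Matrix.mul_assoc]
  have hXq : IsQuat X := hX ▸ (hgq.mul KQ_isQuat).mul hgq.conjTranspose
  have hKdet2 : (KQ p q).det * (KQ p q).det = 1 := by rw [← det_mul, KQ_mul_self, det_one]
  have hXdet : X.det = (KQ p q).det := by
    rw [← hX, det_mul, det_mul, det_conjTranspose, hg1]; simp
  have hXu : IsUnit X.det := by
    rw [hXdet]; exact IsUnit.of_mul_eq_one _ hKdet2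
  have hXX : (X * X).PosDef := by
    have := Matrix.posDef_mul_conjTranspose_self_of_isUnit hXu
    rwa [hXh] at this
  obtain ⟨P, hP, hPX, hPu, hPc⟩ := hXX.exists_unique_sqrt
  have hPq : IsQuat P := (hXq.mul hXq).of_sqrt hP.posSemidef hPX hPu
  have hPXc : P * X = X * P := hPc X (Commute.mul_left (Commute.refl X) (Commute.refl X))
  have hPdet : P.det = 1 := by
    have h1 : P.det * P.det = 1 := by rw [← det_mul, hPX, det_mul, hXdet, hKdet2]
    rcases mul_self_eq_one_iff.mp h1 with h | h
    · exact h
    · have := hP.det_pos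
      rw [h, Complex.pos_iff] at this
      norm_num at this
  set k := g⁻¹ with hk
  have hkg : k * g = 1 := Matrix.nonsing_inv_mul _ hgu
  have hgk : g * k = 1 := Matrix.mul_nonsing_inv _ hgu
  have hgkh : kᴴ * gᴴ = 1 := by rw [← conjTranspose_mul, hgk, conjTranspose_one]
  have hkgh : gᴴ * kᴴ = 1 := by rw [← conjTranspose_mul, hkg, conjTranspose_one]
  have hkq : IsQuat k := hgq.inv hgu
  have hkdet : k.det = 1 := by
    have := congrArg Matrix.det hkg
    rwa [det_mul, hg1, mul_one, det_one] at this
  set S := k * P * kᴴ with hS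
  have hSpd : S.PosDef := by
    have h1 : S.PosSemidef := hP.posSemidef.mul_mul_conjTranspose_same k
    rw [h1.posDef_iff_det_ne_zero, hS, det_mul, det_mul, det_conjTranspose, hkdet, hPdet]
    simp
  have hSdet : S.det = 1 := by
    rw [hS, det_mul, det_mul, det_conjTranspose, hkdet, hPdet]
    simp
  have hSq : IsQuat S := (hkq.mul hPq).mul hkq.conjTranspose
  obtain ⟨h, hh, hhS, hhu, hhc⟩ := hSpd.exists_unique_sqrt
  have hhq : IsQuat h := hSq.of_sqrt hh.posSemidef hhS hhu
  have hhdet : h.det = 1 := by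
    have h1 : h.det * h.det = 1 := by rw [← det_mul, hhS, hSdet]
    rcases mul_self_eq_one_iff.mp h1 with h | h
    · exact h
    · have := hh.det_pos
      rw [h, Complex.pos_iff] at this
      norm_num at this
  have hhu' : IsUnit h.det := by rw [hhdet]; exact isUnit_one
  have hK := KQ_mul_self (p := p) (q := q)
  have hXi : X * (kᴴ * KQ p q * k) = 1 := by
    rw [← hX]
    calc g * KQ p q * gᴴ * (kᴴ * KQ p q * k) = g * KQ p q * (gᴴ * kᴴ) * (KQ p q * k) := by
          simp only [Matrix.mul_assoc]
      _ = g * (KQ p q * KQ p q) * k := by rw [hkgh, Matrix.mul_one]; simp only [Matrix.mul_assoc]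
      _ = 1 := by rw [hK, Matrix.mul_one, hgk]
  have hSKS : S * KQ p q * S = KQ p q := by
    have hkX : k * X * kᴴ = KQ p q := by
      rw [← hX]
      calc k * (g * KQ p q * gᴴ) * kᴴ = (k * g) * KQ p q * (gᴴ * kᴴ) := by
            simp only [Matrix.mul_assoc]
        _ = _ := by rw [hkg, hkgh, Matrix.one_mul, Matrix.mul_one]
    calc S * KQ p q * S = k * (P * (kᴴ * KQ p q * k) * P) * kᴴ := by
          rw [hS]; simp only [Matrix.mul_assoc]
      _ = k * (X * (X * (kᴴ * KQ p q * k))) * kᴴ := by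
          have : P * (kᴴ * KQ p q * k) * P = X * (X * (kᴴ * KQ p q * k)) := by
            have hXi' := mul_eq_one_comm.mp hXi
            generalize kᴴ * KQ p q * k = Xi at hXi hXi' ⊢
            have hc : P * Xi = Xi * P := by
              calc P * Xi = (Xi * X) * P * Xi := by rw [hXi', Matrix.one_mul]
                _ = Xi * (P * X) * Xi := by rw [hPXc]; simp only [Matrix.mul_assoc]
                _ = Xi * P := by rw [Matrix.mul_assoc, Matrix.mul_assoc, hXi, Matrix.mul_one]
            rw [hc, Matrix.mul_assoc, hPX, ← Matrix.mul_assoc, hXi', Matrix.one_mul, hXi,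
              Matrix.mul_one]
          rw [this]
      _ = _ := by rw [hXi, Matrix.mul_one, hkX]
  have hKhK : KQ p q * h⁻¹ * KQ p q = h := by
    apply hhu
    · have := hh.inv.posSemidef.mul_mul_conjTranspose_same (KQ p q)
      rwa [KQ_conjTranspose] at this
    · have hSu : IsUnit S.det := by rw [hSdet]; exact isUnit_one
      calc KQ p q * h⁻¹ * KQ p q * (KQ p q * h⁻¹ * KQ p q)
          = KQ p q * h⁻¹ * (KQ p q * KQ p q) * h⁻¹ * KQ p q := by simp only [Matrix.mul_assoc]
        _ = KQ p q * (h * h)⁻¹ * KQ p q := by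
            rw [hK, Matrix.mul_one, Matrix.mul_inv_rev]; simp only [Matrix.mul_assoc]
        _ = KQ p q * S⁻¹ * (S * KQ p q * S) := by rw [hhS, hSKS]
        _ = KQ p q * (S⁻¹ * S) * KQ p q * S := by simp only [Matrix.mul_assoc]
        _ = S := by rw [Matrix.nonsing_inv_mul _ hSu, Matrix.mul_one, hK, Matrix.one_mul]
  refine ⟨h, P, hhq, hhdet, ?_, hP, hPX, ?_⟩
  · rw [hh.isHermitian.eq]
    calc h * KQ p q * h = KQ p q * h⁻¹ * (KQ p q * KQ p q) * h := by
          conv_lhs => rw [← hKhK]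
          conv_lhs => enter [2]; rw [hKhK]
          simp only [Matrix.mul_assoc]
      _ = _ := by
          rw [hK, Matrix.mul_one, Matrix.mul_assoc, Matrix.nonsing_inv_mul _ hhu', Matrix.mul_one]
  · rw [conjTranspose_mul, hh.isHermitian.eq]
    calc g * h * (h * gᴴ) = g * (h * h) * gᴴ := by simp only [Matrix.mul_assoc]
      _ = (g * k) * P * (kᴴ * gᴴ) := by rw [hhS, hS]; simp only [Matrix.mul_assoc]
      _ = P := by rw [hgk, hgkh, Matrix.one_mul, Matrix.mul_one]

end Orbit

section Scaling
variable {p q : ℕ}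

theorem isQuat_iff_entries {M : Matrix (QIdx p q) (QIdx p q) ℂ} :
    IsQuat M ↔ ∀ i j, M (Sum.inr i) (Sum.inr j) = star (M (Sum.inl i) (Sum.inl j)) ∧
      M (Sum.inr i) (Sum.inl j) = - star (M (Sum.inl i) (Sum.inr j)) := by
  have key : ∀ A B C D : Matrix (Fin p ⊕ Fin q) (Fin p ⊕ Fin q) ℂ,
      IsQuat (fromBlocks A B C D) ↔ matConj C = -B ∧ matConj D = A ∧ -matConj A = -D ∧
        -matConj B = C := by
    intro A B C D
    have : matConj (fromBlocks A B C D) =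
        fromBlocks (matConj A) (matConj B) (matConj C) (matConj D) := by
      simp [matConj, fromBlocks_map]
    unfold IsQuat
    rw [this, OmegaQ, fromBlocks_multiply, fromBlocks_multiply, fromBlocks_inj]
    simp
  rw [← fromBlocks_toBlocks M, key]
  constructor
  · rintro ⟨-, -, h3, h4⟩ i j
    refine ⟨?_, ?_⟩
    · rw [← neg_inj.mp h3]; simp [matConj]
    · rw [← h4]; simp [matConj]
  · intro h
    refine ⟨?_, ?_, ?_, ?_⟩ <;> ext i j <;> have h1 := (h i j).1 <;> have h2 := (h i j).2 <;>
      simp only [fromBlocks_apply₁₁, fromBlocks_apply₁₂, fromBlocks_apply₂₁,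
        fromBlocks_apply₂₂] at h1 h2 <;> simp [matConj, h1, h2]

variable (r : Fin p ⊕ Fin q → ℝ)

/-- Strictly upper triangular index pairs. -/
abbrev UpperPair (r : Fin p ⊕ Fin q → ℝ) :=
  {x : (Fin p ⊕ Fin q) × (Fin p ⊕ Fin q) // r x.1 < r x.2}

/-- Independent entries of a Hermitian quaternionic matrix. -/
def hermQuatCoord : hermQuat p q →ₗ[ℝ] (Fin p ⊕ Fin q → ℝ) × (UpperPair r → ℂ × ℂ) where
  toFun X := (fun i => (X.1 (Sum.inl i) (Sum.inl i)).re,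
    fun x => (X.1 (Sum.inl x.1.1) (Sum.inl x.1.2), X.1 (Sum.inl x.1.1) (Sum.inr x.1.2)))
  map_add' X Y := by ext <;> simp
  map_smul' c X := by ext <;> simp

theorem hermQuatCoord_bijective (hr : Function.Injective r) :
    Function.Bijective (hermQuatCoord r) := by
  constructor
  · rw [← LinearMap.ker_eq_bot, LinearMap.ker_eq_bot']
    rintro ⟨X, hXh, hXq⟩ h
    rw [isQuat_iff_entries] at hXq
    have hH : ∀ i j, star (X j i) = X i j := fun i j => by
      conv_rhs => rw [← hXh]
      rfl
    have hd : ∀ i, (X (Sum.inl i) (Sum.inl i)).re = 0 := fun i => congrFun (congrArg Prod.fst h) i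
    have hu : ∀ i j, r i < r j → X (Sum.inl i) (Sum.inl j) = 0 ∧ X (Sum.inl i) (Sum.inr j) = 0 := by
      intro i j hij
      have := congrFun (congrArg Prod.snd h) ⟨(i, j), hij⟩
      exact ⟨congrArg Prod.fst this, congrArg Prod.snd this⟩
    have hB : ∀ i j, X (Sum.inl i) (Sum.inl j) = 0 := by
      intro i j
      rcases lt_trichotomy (r i) (r j) with hij | hij | hij
      · exact (hu i j hij).1
      · obtain rfl := hr hij
        have := hH (Sum.inl i) (Sum.inl i)
        refine Complex.ext (hd i) ?_
        exact Complex.conj_eq_iff_im.mp this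
      · rw [← hH, (hu j i hij).1, star_zero]
    have hsk : ∀ i j, X (Sum.inl i) (Sum.inr j) = - X (Sum.inl j) (Sum.inr i) := by
      intro i j
      rw [← hH, (hXq j i).2, star_neg, star_star]
    have hC : ∀ i j, X (Sum.inl i) (Sum.inr j) = 0 := by
      intro i j
      rcases lt_trichotomy (r i) (r j) with hij | hij | hij
      · exact (hu i j hij).2
      · obtain rfl := hr hij
        exact self_eq_neg.mp (hsk i i)
      · rw [hsk, (hu j i hij).2, neg_zero]
    refine Subtype.ext ?_
    ext (i | i) (j | j)
    · exact hB i j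
    · exact hC i j
    · change X _ _ = 0; rw [(hXq i j).2, hC, star_zero, neg_zero]
    · change X _ _ = 0; rw [(hXq i j).1, hB, star_zero]
  · rintro ⟨d, f⟩
    classical
    let B : Matrix (Fin p ⊕ Fin q) (Fin p ⊕ Fin q) ℂ := fun i j =>
      if h : r i < r j then (f ⟨(i, j), h⟩).1 else
        if h : r j < r i then star (f ⟨(j, i), h⟩).1 else d i
    let C : Matrix (Fin p ⊕ Fin q) (Fin p ⊕ Fin q) ℂ := fun i j =>
      if h : r i < r j then (f ⟨(i, j), h⟩).2 else
        if h : r j < r i then - (f ⟨(j, i), h⟩).2 else 0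
    have hB : ∀ i j, star (B j i) = B i j := by
      intro i j
      rcases lt_trichotomy (r i) (r j) with hij | hij | hij
      · simp [B, hij, hij.not_gt]
      · obtain rfl := hr hij
        simp [B]
      · simp [B, hij, hij.not_gt]
    have hC : ∀ i j, C j i = - C i j := by
      intro i j
      rcases lt_trichotomy (r i) (r j) with hij | hij | hij
      · simp [C, hij, hij.not_gt]
      · obtain rfl := hr hij
        simp [C]
      · simp [C, hij, hij.not_gt]
    refine ⟨⟨fromBlocks B C (-matConj C) (matConj B), ?_, ?_⟩, ?_⟩
    · rw [fromBlocks_conjTranspose, fromBlocks_inj]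
      refine ⟨?_, ?_, ?_, ?_⟩
      · ext i j; exact hB i j
      · ext i j; simp [matConj, hC i j]
      · ext i j; simp [matConj, hC j i]
      · ext i j
        simp only [matConj, conjTranspose_apply, map_apply]
        rw [← hB i j]
        rfl
    · rw [isQuat_iff_entries]
      intro i j
      simp [matConj]
    · refine Prod.ext ?_ ?_
      · funext i
        change (B i i).re = d i
        simp [B]
      · funext x
        have := x.2
        change (B _ _, C _ _) = f x
        simp only [B, C, this, dif_pos]

theorem det_hermQuat_scaling (hr : Function.Injective r) (c : Fin p ⊕ Fin q → Fin p ⊕ Fin q → ℝ)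
    (L : hermQuat p q →ₗ[ℝ] hermQuat p q)
    (hL : ∀ X i j, (L X).1 i j = c (Sum.elim id id i) (Sum.elim id id j) * X.1 i j) :
    LinearMap.det L = (∏ i, c i i) * ∏ x : UpperPair r, c x.1.1 x.1.2 ^ 4 := by
  let e := LinearEquiv.ofBijective (hermQuatCoord r) (hermQuatCoord_bijective r hr)
  rw [← LinearMap.det_conj L e]
  have h : (e.toLinearMap ∘ₗ L ∘ₗ e.symm.toLinearMap :
      ((Fin p ⊕ Fin q → ℝ) × (UpperPair r → ℂ × ℂ)) →ₗ[ℝ] _) =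
      LinearMap.prodMap (LinearMap.pi fun i => (c i i • LinearMap.id) ∘ₗ LinearMap.proj i)
        (LinearMap.pi fun x : UpperPair r => (c x.1.1 x.1.2 • LinearMap.id) ∘ₗ LinearMap.proj x) := by
    refine LinearMap.ext fun y => ?_
    obtain ⟨X, rfl⟩ := e.surjective y
    simp only [LinearMap.comp_apply, LinearEquiv.coe_coe, e.symm_apply_apply]
    refine Prod.ext ?_ ?_
    · funext i
      change ((L X).1 _ _).re = c i i * (X.1 _ _).re
      rw [hL]
      simp
    · funext x
      change ((L X).1 _ _, (L X).1 _ _) = c x.1.1 x.1.2 • (X.1 _ _, X.1 _ _)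
      rw [hL, hL]
      simp
  rw [h, LinearMap.det_prodMap, LinearMap.det_pi, LinearMap.det_pi]
  congr 1
  · refine Finset.prod_congr rfl fun i _ => ?_
    rw [LinearMap.det_smul]; simp
  · refine Finset.prod_congr rfl fun i _ => ?_
    rw [LinearMap.det_smul]; simp [Module.finrank_prod, Complex.finrank_real_complex]

end Scaling

section Potential
open scoped Matrix.Norms.Frobenius

theorem frobenius_norm_sq {ι : Type*} [Fintype ι] (X : Matrix ι ι ℂ) :
    ‖X‖ ^ 2 = (Xᴴ * X).trace.re := by
  rw [Matrix.frobenius_norm_def, ← Real.rpow_natCast, ← Real.rpow_mul (by positivity)]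
  simp only [Matrix.trace, Matrix.diag, Matrix.mul_apply, conjTranspose_apply, Complex.re_sum]
  rw [Finset.sum_comm]
  norm_num
  refine Finset.sum_congr rfl fun i _ => Finset.sum_congr rfl fun j _ => ?_
  rw [Complex.sq_norm, Complex.normSq_apply]

/-- The potential `X² + [X, [X, A]]`. -/
def commPotential {ι : Type*} [Fintype ι] (X A : Matrix ι ι ℂ) : Matrix ι ι ℂ :=
  X * X + (X * X * A - (2 : ℝ) • (X * A * X) + A * X * X)

theorem commPotential_norm_sq {ι : Type*} [Fintype ι] [DecidableEq ι] {X A : Matrix ι ι ℂ}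
    (hX : Xᴴ = X) :
    ‖commPotential X A - 1‖ ^ 2 =
      ‖X * X - 1‖ ^ 2 + ‖X * X * A - (2 : ℝ) • (X * A * X) + A * X * X‖ ^ 2 := by
  set Y := X * X - 1 with hY
  set Z := X * X * A - (2 : ℝ) • (X * A * X) + A * X * X with hZ
  have h1 : commPotential X A - 1 = Y + Z := by rw [commPotential, hY, hZ]; abel
  have hYh : Yᴴ = Y := by rw [hY]; simp [hX]
  have hYX : Y * X = X * Y := by rw [hY]; simp [sub_mul, mul_sub, Matrix.mul_assoc]
  have hYZ : (Y * Z).trace = 0 := by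
    have e1 : (Y * (X * A * X)).trace = (Y * (X * X * A)).trace := by
      calc (Y * (X * A * X)).trace = (Y * (X * A) * X).trace := by simp only [Matrix.mul_assoc]
        _ = (X * (Y * (X * A))).trace := Matrix.trace_mul_comm _ _
        _ = ((X * Y) * (X * A)).trace := by simp only [Matrix.mul_assoc]
        _ = (Y * (X * X * A)).trace := by rw [← hYX]; simp only [Matrix.mul_assoc]
    have e2 : (Y * (A * X * X)).trace = (Y * (X * X * A)).trace := by
      calc (Y * (A * X * X)).trace = (Y * A * (X * X)).trace := by simp only [Matrix.mul_assoc]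
        _ = (X * X * (Y * A)).trace := Matrix.trace_mul_comm _ _
        _ = (X * (X * Y) * A).trace := by simp only [Matrix.mul_assoc]
        _ = (X * (Y * X) * A).trace := by rw [hYX]
        _ = (X * Y * X * A).trace := by simp only [Matrix.mul_assoc]
        _ = (Y * (X * X * A)).trace := by rw [← hYX]; simp only [Matrix.mul_assoc]
    rw [hZ, mul_add, mul_sub, Matrix.mul_smul, trace_add, trace_sub, trace_smul, e1, e2]
    rw [two_smul]; ring
  have hZY : (Zᴴ * Y).trace = 0 := by
    have := congrArg star hYZ
    rw [← trace_conjTranspose, conjTranspose_mul, hYh, star_zero] at this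
    exact this
  clear_value Y Z
  rw [h1, frobenius_norm_sq, frobenius_norm_sq, frobenius_norm_sq, conjTranspose_add, add_mul,
    mul_add, mul_add, trace_add, trace_add, trace_add, hZY, hYh, hYZ]
  simp

theorem norm_mul_self_sub_one_le {ι : Type*} [Fintype ι] [DecidableEq ι] {X A : Matrix ι ι ℂ}
    (hX : Xᴴ = X) : ‖X * X - 1‖ ^ 2 ≤ ‖commPotential X A - 1‖ ^ 2 := by
  rw [commPotential_norm_sq hX]
  exact le_add_of_nonneg_right (by positivity)

theorem commPotential_eq_one_iff {ι : Type*} [Fintype ι] [DecidableEq ι] {X A : Matrix ι ι ℂ}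
    (hX : Xᴴ = X) : commPotential X A = 1 ↔ X * X = 1 ∧ X * A = A * X := by
  constructor
  · intro h
    have h1 := commPotential_norm_sq (A := A) hX
    rw [h, sub_self, norm_zero] at h1
    have h2 : ‖X * X - 1‖ ^ 2 = 0 := by
      nlinarith [sq_nonneg (‖X * X - 1‖),
        sq_nonneg (‖X * X * A - (2 : ℝ) • (X * A * X) + A * X * X‖)]
    have h3 : X * X = 1 := sub_eq_zero.mp (norm_eq_zero.mp (pow_eq_zero_iff two_ne_zero |>.mp h2))
    refine ⟨h3, ?_⟩
    rw [commPotential, h3, Matrix.one_mul, Matrix.mul_assoc A, h3, Matrix.mul_one] at h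
    have h4 : (2 : ℝ) • (A - X * A * X) = 0 := by
      rw [smul_sub, two_smul ℝ A]
      have := add_eq_left.mp h
      rw [← this]; abel
    have h5 : A = X * A * X := sub_eq_zero.mp ((smul_eq_zero.mp h4).resolve_left two_ne_zero)
    calc X * A = X * A * (X * X) := by rw [h3, Matrix.mul_one]
      _ = (X * A * X) * X := by simp only [Matrix.mul_assoc]
      _ = A * X := by rw [← h5]
  · rintro ⟨h1, h2⟩
    rw [commPotential, h1, Matrix.one_mul, h2, Matrix.mul_assoc A, h1, Matrix.mul_one, two_smul]
    abel

theorem IsQuat.commPotential {p q : ℕ} {X A : Matrix (QIdx p q) (QIdx p q) ℂ} (hX : IsQuat X)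
    (hA : IsQuat A) : IsQuat (commPotential X A) :=
  (hX.mul hX).add ((((hX.mul hX).mul hA).sub (((hX.mul hA).mul hX).smul 2)).add
    ((hA.mul hX).mul hX))

theorem commPotential_mem {p q : ℕ} {X A : Matrix (QIdx p q) (QIdx p q) ℂ} (hX : X ∈ hermQuat p q)
    (hA : A ∈ hermQuat p q) : commPotential X A ∈ hermQuat p q := by
  refine ⟨?_, hX.2.commPotential hA.2⟩
  unfold _root_.commPotential
  simp only [conjTranspose_add, conjTranspose_sub, conjTranspose_mul, hX.1, hA.1,
    conjTranspose_smul, Matrix.mul_assoc]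
  simp
  abel

theorem hasFDerivAt_commPotential {ι : Type*} [Fintype ι] [DecidableEq ι]
    (V : Submodule ℝ (Matrix ι ι ℂ)) (A : Matrix ι ι ℂ) (X Y : V) :
    DifferentiableAt ℝ (fun Z : V => commPotential Z.1 A) X ∧
    fderiv ℝ (fun Z : V => commPotential Z.1 A) X Y =
      (X.1 * Y.1 + Y.1 * X.1) + ((X.1 * Y.1 + Y.1 * X.1) * A
        - (2 : ℝ) • (X.1 * A * Y.1 + Y.1 * A * X.1) + A * (X.1 * Y.1 + Y.1 * X.1)) := by
  have h0 : HasFDerivAt (fun Z : V => Z.1) V.subtypeL X := V.subtypeL.hasFDerivAt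
  have h1 := h0.mul' h0
  have h2 := (h0.mul_const' A).mul' h0
  have h3 := h1.const_mul A
  have h := h1.add (((h1.mul_const' A).sub (h2.const_smul (2 : ℝ))).add h3)
  have he : (fun Z : V => commPotential Z.1 A) = (fun Z : V => Z.1) * (fun Z : V => Z.1) +
      ((fun Z : V => ((fun Z : V => Z.1) * (fun Z : V => Z.1)) Z * A) -
        (2 : ℝ) • ((fun Z : V => Z.1 * A) * (fun Z : V => Z.1)) +
        fun Z : V => A * ((fun Z : V => Z.1) * (fun Z : V => Z.1)) Z) := by
    funext Z
    simp [commPotential, Matrix.mul_assoc]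
  rw [← he] at h
  refine ⟨h.differentiableAt, ?_⟩
  exact DFunLike.congr_fun h.fderiv Y

end Potential

section DiagonalPoint
variable {p q : ℕ}

/-- An injective real labelling of the quaternionic coordinates. -/
def coordLabel : Fin p ⊕ Fin q → ℝ := Sum.elim (fun i => (i : ℝ)) (fun j => (p : ℝ) + (j : ℝ))

theorem coordLabel_injective : Function.Injective (coordLabel (p := p) (q := q)) := by
  have h : ∀ (i : Fin p) (j : Fin q), (i : ℝ) < (p : ℝ) + (j : ℝ) := by
    intro i j
    have h1 : (i : ℝ) < (p : ℝ) := by exact_mod_cast i.2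
    have h2 : (0 : ℝ) ≤ (j : ℝ) := by positivity
    linarith
  rintro (i | i) (j | j) hij <;> simp only [coordLabel, Sum.elim_inl, Sum.elim_inr] at hij
  · exact congrArg Sum.inl (Fin.ext (by exact_mod_cast hij))
  · exact absurd hij (h i j).ne
  · exact absurd hij (h j i).ne'
  · exact congrArg Sum.inr (Fin.ext (by exact_mod_cast (add_left_cancel hij)))

/-- The real diagonal matrix `diag(a, a)`. -/
def realDiag (d : Fin p ⊕ Fin q → ℝ) : Matrix (QIdx p q) (QIdx p q) ℂ :=
  Matrix.diagonal (Sum.elim (fun i => (d i : ℂ)) (fun i => (d i : ℂ)))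

theorem realDiag_mem (d : Fin p ⊕ Fin q → ℝ) : realDiag d ∈ hermQuat p q := by
  refine ⟨?_, IsQuat.diagonal d⟩
  unfold realDiag
  rw [diagonal_conjTranspose]
  congr 1
  funext i
  rcases i with i | i <;> simp

theorem realDiag_eq (d : Fin p ⊕ Fin q → ℝ) :
    realDiag d = Matrix.diagonal (fun i => ((d (Sum.elim id id i) : ℝ) : ℂ)) := by
  unfold realDiag
  congr 1
  funext i
  rcases i with i | i <;> simp

theorem KQ_trace : (KQ p q).trace = ((2 * ((p : ℝ) - q) : ℝ) : ℂ) := by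
  simp [KQ, Matrix.trace, Fintype.sum_sum_type]
  ring

theorem prod_eq_of_sum_eq (d : Fin p ⊕ Fin q → ℝ) (hd : ∀ i, d i = 1 ∨ d i = -1)
    (hsum : ∑ i, d i = (p : ℝ) - q) : ∏ i, d i = (-1) ^ q := by
  classical
  set s := Finset.univ.filter fun i => d i = -1 with hs
  have h1 : ∀ i, d i = if i ∈ s then -1 else 1 := by
    intro i
    by_cases h : d i = -1
    · simp [hs, h]
    · simp [hs, (hd i).resolve_right h]
  have h2 : ∑ i, d i = (p + q : ℝ) - 2 * s.card := by
    have : ∀ i, d i = 1 - 2 * (if i ∈ s then 1 else 0) := by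
      intro i; rw [h1]; split_ifs <;> norm_num
    simp_rw [this]
    rw [Finset.sum_sub_distrib, ← Finset.mul_sum]
    simp
  have h3 : s.card = q := by
    have : (s.card : ℝ) = q := by linarith
    exact_mod_cast this
  simp_rw [h1]
  rw [Finset.prod_ite_mem]
  simp [h3]

theorem eq_realDiag_of_commute {X : Matrix (QIdx p q) (QIdx p q) ℂ} (hX : X ∈ hermQuat p q)
    (hXX : X * X = 1) (hc : X * realDiag coordLabel = realDiag coordLabel * X)
    (htr : X.trace = (KQ p q).trace) :
    ∃ d : Fin p ⊕ Fin q → ℝ, (∀ i, d i = 1 ∨ d i = -1) ∧ X = realDiag d ∧ ∏ i, d i = (-1) ^ q := by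
  have hq := isQuat_iff_entries.mp hX.2
  have hH : ∀ i j, star (X j i) = X i j := fun i j => by
    conv_rhs => rw [← hX.1]
    rfl
  have h0 : ∀ i j : QIdx p q, Sum.elim id id i ≠ (Sum.elim id id j : Fin p ⊕ Fin q) → X i j = 0 := by
    intro i j hij
    have h := congrFun (congrFun hc i) j
    rw [realDiag_eq, Matrix.mul_diagonal, Matrix.diagonal_mul] at h
    have hne : ((coordLabel (Sum.elim id id i : Fin p ⊕ Fin q) : ℝ) : ℂ) ≠
        ((coordLabel (Sum.elim id id j : Fin p ⊕ Fin q) : ℝ) : ℂ) := by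
      intro h
      exact hij (coordLabel_injective (Complex.ofReal_injective h))
    have h2 : (((coordLabel (Sum.elim id id i : Fin p ⊕ Fin q) : ℝ) : ℂ) -
        ((coordLabel (Sum.elim id id j : Fin p ⊕ Fin q) : ℝ) : ℂ)) * X i j = 0 := by
      linear_combination -h
    exact (mul_eq_zero.mp h2).resolve_left (sub_ne_zero.mpr hne)
  have hlr : ∀ i j, X (Sum.inl i) (Sum.inr j) = 0 := by
    intro i j
    by_cases hij : i = j
    · subst hij
      have := hH (Sum.inl i) (Sum.inr i)
      rw [(hq i i).2, star_neg, star_star] at this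
      exact self_eq_neg.mp this.symm
    · exact h0 (Sum.inl i) (Sum.inr j) hij
  have hrl : ∀ i j, X (Sum.inr i) (Sum.inl j) = 0 := by
    intro i j
    rw [(hq i j).2, hlr, star_zero, neg_zero]
  have hre : ∀ i, X (Sum.inl i) (Sum.inl i) = (((X (Sum.inl i) (Sum.inl i)).re : ℝ) : ℂ) := by
    intro i
    exact (Complex.conj_eq_iff_re.mp (hH (Sum.inl i) (Sum.inl i))).symm
  have hXd : X = realDiag fun i => (X (Sum.inl i) (Sum.inl i)).re := by
    ext (i | i) (j | j)
    · by_cases hij : i = j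
      · subst hij
        simp only [realDiag, diagonal_apply_eq, Sum.elim_inl]
        exact hre i
      · rw [h0 (Sum.inl i) (Sum.inl j) hij]
        simp [realDiag, hij]
    · rw [hlr]; simp [realDiag]
    · rw [hrl]; simp [realDiag]
    · rw [(hq i j).1]
      by_cases hij : i = j
      · subst hij
        simp only [realDiag, diagonal_apply_eq, Sum.elim_inr]
        rw [hH]; exact hre i
      · rw [h0 (Sum.inl i) (Sum.inl j) hij]
        simp [realDiag, hij]
  refine ⟨_, ?_, hXd, ?_⟩
  · intro i
    have h := congrFun (congrFun hXX (Sum.inl i)) (Sum.inl i)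
    rw [hXd] at h
    simp only [realDiag, diagonal_mul_diagonal, diagonal_apply_eq, Sum.elim_inl, one_apply_eq] at h
    exact mul_self_eq_one_iff.mp (by exact_mod_cast h)
  · refine prod_eq_of_sum_eq _ ?_ ?_
    · intro i
      have h := congrFun (congrFun hXX (Sum.inl i)) (Sum.inl i)
      rw [hXd] at h
      simp only [realDiag, diagonal_mul_diagonal, diagonal_apply_eq, Sum.elim_inl, one_apply_eq] at h
      exact mul_self_eq_one_iff.mp (by exact_mod_cast h)
    · rw [hXd, KQ_trace] at htr
      simp only [realDiag, trace_diagonal, Fintype.sum_sum_type, Sum.elim_inl, Sum.elim_inr] at htr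
      have h2 : (2 : ℝ) * ∑ i, (X (Sum.inl i) (Sum.inl i)).re = 2 * ((p : ℝ) - q) := by
        rw [Fintype.sum_sum_type]
        apply Complex.ofReal_injective
        rw [← htr]
        push_cast
        ring
      linarith

end DiagonalPoint

section Smoothness
open scoped Matrix.Norms.Frobenius Topology

theorem ContDiff.of_coe_submodule {E F : Type*} [NormedAddCommGroup E] [NormedSpace ℝ E]
    [NormedAddCommGroup F] [NormedSpace ℝ F] [FiniteDimensional ℝ F] (V : Submodule ℝ F)
    {n : WithTop ℕ∞} {f : E → V} (hf : ContDiff ℝ n fun x => (f x : F)) : ContDiff ℝ n f := by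
  obtain ⟨π, hπ⟩ := V.subtype.exists_leftInverse_of_injective (by simp)
  have h : f = fun x => LinearMap.toContinuousLinearMap π (f x : F) := by
    funext x
    exact (LinearMap.congr_fun hπ (f x)).symm
  rw [h]
  exact (LinearMap.toContinuousLinearMap π).contDiff.comp hf

theorem ContDiff.frobenius_norm_sq {E ι : Type*} [NormedAddCommGroup E] [NormedSpace ℝ E]
    [Fintype ι] {n : WithTop ℕ∞} {f : E → Matrix ι ι ℂ} (hf : ContDiff ℝ n f) :
    ContDiff ℝ n fun x => ‖f x‖ ^ 2 := by
  have h : (fun x => ‖f x‖ ^ 2) = fun x => ∑ i, ∑ j, ‖f x i j‖ ^ 2 := by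
    funext x
    rw [Matrix.frobenius_norm_def, ← Real.rpow_natCast, ← Real.rpow_mul (by positivity)]
    norm_num
  rw [h]
  refine ContDiff.sum fun i _ => ContDiff.sum fun j _ => ContDiff.norm_sq ℝ ?_
  exact (LinearMap.toContinuousLinearMap
    (Matrix.entryLinearMap ℝ ℂ i j : Matrix ι ι ℂ →ₗ[ℝ] ℂ)).contDiff.comp hf

theorem IsCompact.exists_pos_forall_le {X : Type*} [TopologicalSpace X] {T : Set X}
    (hT : IsCompact T) {f : X → ℝ} (hf : Continuous f) (hpos : ∀ x ∈ T, 0 < f x) :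
    ∃ ε > 0, ∀ x ∈ T, ε ≤ f x := by
  rcases T.eq_empty_or_nonempty with rfl | hne
  · exact ⟨1, one_pos, by simp⟩
  · obtain ⟨x, hx, hmin⟩ := hT.exists_isMinOn hne hf.continuousOn
    exact ⟨f x, hpos x hx, fun y hy => hmin hy⟩

end Smoothness

section DetSign
open scoped Matrix.Norms.Frobenius Topology
variable {p q : ℕ}

theorem det_fderiv_commPotential_pos (Φ : hermQuat p q → hermQuat p q)
    (hΦ : ∀ X, (Φ X).1 = commPotential X.1 (realDiag coordLabel)) (hd : Differentiable ℝ Φ)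
    (X : hermQuat p q) {d : Fin p ⊕ Fin q → ℝ} (hd1 : ∀ i, d i = 1 ∨ d i = -1)
    (hX : X.1 = realDiag d) (hprod : ∏ i, d i = (-1) ^ q) :
    0 < (-1 : ℝ) ^ q * (fderiv ℝ Φ X).det := by
  set r : Fin p ⊕ Fin q → ℝ := coordLabel with hr
  set c : Fin p ⊕ Fin q → Fin p ⊕ Fin q → ℝ :=
    fun i j => (d i + d j) + (d i - d j) * (r j - r i) with hc
  have key : ∀ Y : hermQuat p q, ((fderiv ℝ Φ X) Y).1 =
      (X.1 * Y.1 + Y.1 * X.1) + ((X.1 * Y.1 + Y.1 * X.1) * (realDiag r)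
        - (2 : ℝ) • (X.1 * (realDiag r) * Y.1 + Y.1 * (realDiag r) * X.1)
        + (realDiag r) * (X.1 * Y.1 + Y.1 * X.1)) := by
    intro Y
    rw [← (hasFDerivAt_commPotential (hermQuat p q) (realDiag r) X Y).2]
    have h1 : (fun Z : hermQuat p q => commPotential Z.1 (realDiag r)) =
        fun Z => (hermQuat p q).subtypeL (Φ Z) := by
      funext Z; exact (hΦ Z).symm
    rw [h1]
    have h2 := ((hermQuat p q).subtypeL.hasFDerivAt (x := Φ X)).comp X (hd X).hasFDerivAt
    exact (DFunLike.congr_fun h2.fderiv Y).symm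
  have hL : ∀ (Y : hermQuat p q) i j, ((fderiv ℝ Φ X).toLinearMap Y).1 i j =
      c (Sum.elim id id i) (Sum.elim id id j) * Y.1 i j := by
    intro Y i j
    refine (congrFun (congrFun (key Y) i) j).trans ?_
    rw [hX, realDiag_eq, realDiag_eq]
    simp only [Matrix.add_apply, Matrix.sub_apply, Matrix.smul_apply, Matrix.mul_diagonal,
      Matrix.diagonal_mul, Matrix.mul_assoc, Matrix.diagonal_mul_diagonal, hc, Complex.real_smul]
    push_cast
    ring
  have hdet : (fderiv ℝ Φ X).det = _ :=
    det_hermQuat_scaling r coordLabel_injective c (fderiv ℝ Φ X).toLinearMap hL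
  rw [hdet]
  have h1 : ∏ i, c i i = 2 ^ (Fintype.card (Fin p ⊕ Fin q)) * (-1) ^ q := by
    have : ∀ i, c i i = 2 * d i := fun i => by simp only [hc]; ring
    simp_rw [this]
    rw [Finset.prod_mul_distrib, hprod, Finset.prod_const, Finset.card_univ]
  have h2 : 0 < ∏ x : UpperPair r, c x.1.1 x.1.2 ^ 4 := by
    refine Finset.prod_pos fun x _ => ?_
    have hne : c x.1.1 x.1.2 ≠ 0 := by
      have hrx : r x.1.2 - r x.1.1 ≠ 0 := sub_ne_zero.mpr (ne_of_gt x.2)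
      simp only [hc]
      rcases hd1 x.1.1 with h | h <;> rcases hd1 x.1.2 with h' | h' <;> rw [h, h'] <;> norm_num
      · exact fun h => hrx h
      · exact fun h => hrx h
    positivity
  have h3 : (-1 : ℝ) ^ q * (-1) ^ q = 1 := by rw [← mul_pow]; norm_num
  rw [h1]
  have : (-1 : ℝ) ^ q * (2 ^ Fintype.card (Fin p ⊕ Fin q) * (-1) ^ q *
      ∏ x : UpperPair r, c x.1.1 x.1.2 ^ 4) =
      ((-1 : ℝ) ^ q * (-1) ^ q) * (2 ^ Fintype.card (Fin p ⊕ Fin q) *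
      ∏ x : UpperPair r, c x.1.1 x.1.2 ^ 4) := by ring
  rw [this, h3]
  positivity

end DetSign

section Compactness
open scoped Matrix.Norms.Frobenius Topology
variable {p q : ℕ}

theorem isClosed_setOf_isQuat : IsClosed {u : Matrix (QIdx p q) (QIdx p q) ℂ | IsQuat u} := by
  unfold IsQuat matConj
  refine isClosed_eq (continuous_const.matrix_mul (Continuous.matrix_map continuous_id ?_))
    (continuous_id.matrix_mul continuous_const)
  exact Complex.continuous_conj

theorem isCompact_unitary_quat : IsCompact {u : Matrix (QIdx p q) (QIdx p q) ℂ |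
    u * uᴴ = 1 ∧ IsQuat u ∧ u.det = 1} := by
  refine Metric.isCompact_of_isClosed_isBounded ?_ ?_
  · refine (isClosed_eq ?_ continuous_const).inter (isClosed_setOf_isQuat.inter
      (isClosed_eq ?_ continuous_const))
    · fun_prop
    · fun_prop
  · refine (Metric.isBounded_closedBall (x := 0)
      (r := Real.sqrt (Fintype.card (QIdx p q)))).subset ?_
    rintro u ⟨h1, -, -⟩
    have h1' : uᴴ * u = 1 := mul_eq_one_comm.mp h1
    rw [mem_closedBall_zero_iff]
    refine Real.le_sqrt_of_sq_le ?_
    rw [frobenius_norm_sq, h1']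
    simp

theorem isCompact_unitaryOrbit : IsCompact (unitaryOrbit p q) := by
  have h := (isCompact_unitary_quat (p := p) (q := q)).image
    (f := fun u => u * KQ p q * uᴴ) (by fun_prop)
  convert h using 1
  ext X
  simp only [unitaryOrbit, Set.mem_ofPred_eq, Set.mem_image]
  constructor
  · rintro ⟨u, h1, h2, h3, h4⟩; exact ⟨u, ⟨h1, h2, h3⟩, h4⟩
  · rintro ⟨u, ⟨h1, h2, h3⟩, h4⟩; exact ⟨u, h1, h2, h3, h4⟩

theorem isCompact_norm_mul_self_sub_one_le :
    IsCompact {X : hermQuat p q | ‖X.1 * X.1 - 1‖ ^ 2 ≤ 1} := by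
  refine Metric.isCompact_of_isClosed_isBounded (isClosed_le (by fun_prop) continuous_const) ?_
  obtain ⟨C, hC0, hC⟩ := SemilinearMapClass.bound_of_continuous
    (Matrix.traceLinearMap (QIdx p q) ℝ ℂ) (LinearMap.continuous_of_finiteDimensional _)
  refine (Metric.isBounded_closedBall (x := 0)
    (r := Real.sqrt (C * (1 + ‖(1 : Matrix (QIdx p q) (QIdx p q) ℂ)‖)))).subset ?_
  intro X hX
  rw [mem_closedBall_zero_iff]
  refine Real.le_sqrt_of_sq_le ?_
  have h1 : ‖X.1 * X.1 - 1‖ ≤ 1 := by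
    have : ‖X.1 * X.1 - 1‖ ^ 2 ≤ 1 := hX
    exact (sq_le_one_iff₀ (norm_nonneg _)).mp this
  have h2 : ‖X.1 * X.1‖ ≤ 1 + ‖(1 : Matrix (QIdx p q) (QIdx p q) ℂ)‖ := by
    have := norm_add_le (X.1 * X.1 - 1) 1
    rw [sub_add_cancel] at this
    linarith
  calc ‖X‖ ^ 2 = ‖X.1‖ ^ 2 := rfl
    _ = (X.1 * X.1).trace.re := by rw [frobenius_norm_sq, X.2.1]
    _ ≤ ‖(X.1 * X.1).trace‖ := Complex.re_le_norm _
    _ ≤ C * ‖X.1 * X.1‖ := hC _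
    _ ≤ _ := by gcongr

theorem isClosed_involution_diff_unitaryOrbit :
    IsClosed {X : hermQuat p q | X.1 * X.1 = 1 ∧ X.1 ∉ unitaryOrbit p q} := by
  rw [← isOpen_compl_iff, isOpen_iff_mem_nhds]
  intro X hX
  by_cases h : X.1 * X.1 = 1
  · have hX' : X.1 ∈ unitaryOrbit p q := by
      by_contra h'
      exact hX ⟨h, h'⟩
    have h1 := (continuous_subtype_val.tendsto X).eventually (eventually_mem_unitaryOrbit hX')
    filter_upwards [h1] with Y hY hYY
    exact hYY.2 (hY Y.2 hYY.1)
  · have h1 : ∀ᶠ Y : hermQuat p q in 𝓝 X, Y.1 * Y.1 ≠ 1 :=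
      (show Continuous fun Y : hermQuat p q => Y.1 * Y.1 by fun_prop).continuousAt.eventually_ne h
    filter_upwards [h1] with Y hY hYY
    exact hY hYY.1

end Compactness

section CommutingPoint
open scoped Matrix.Norms.Frobenius Topology Manifold
variable {p q : ℕ}

theorem exists_contDiff_zero_one_nhds_of_isClosed {V : Type*} [NormedAddCommGroup V]
    [NormedSpace ℝ V] [FiniteDimensional ℝ V] {s t : Set V} (hs : IsClosed s) (ht : IsClosed t)
    (hd : Disjoint s t) : ∃ η : V → ℝ, ContDiff ℝ 3 η ∧ (∀ x, 0 ≤ η x) ∧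
      (∀ x ∈ s, ∀ᶠ y in 𝓝 x, η y = 0) ∧ ∀ x ∈ t, ∀ᶠ y in 𝓝 x, η y = 1 := by
  obtain ⟨η, h0, h1, h01⟩ := exists_contMDiffMap_zero_one_nhds_of_isClosed (n := 3)
    (I := 𝓘(ℝ, V)) hs ht hd
  exact ⟨η, contMDiff_iff_contDiff.mp η.contMDiff, fun x => (h01 x).1,
    fun x hx => h0.filter_mono (nhds_le_nhdsSet hx),
    fun x hx => h1.filter_mono (nhds_le_nhdsSet hx)⟩

theorem exists_smooth_cutoff : ∃ η : hermQuat p q → ℝ, ContDiff ℝ 3 η ∧ (∀ X, 0 ≤ η X) ∧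
    (∀ X : hermQuat p q, X.1 ∈ unitaryOrbit p q → ∀ᶠ Y in 𝓝 X, η Y = 1) ∧
    ∀ X : hermQuat p q, X.1 * X.1 = 1 → X.1 ∉ unitaryOrbit p q → ∀ᶠ Y in 𝓝 X, η Y = 0 := by
  obtain ⟨η, h1, h2, h3, h4⟩ := exists_contDiff_zero_one_nhds_of_isClosed
    (isClosed_involution_diff_unitaryOrbit (p := p) (q := q))
    (isCompact_unitaryOrbit.isClosed.preimage
      (continuous_subtype_val (p := fun X => X ∈ hermQuat p q)))
    (Set.disjoint_left.mpr fun X hX hX' => hX.2 hX')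
  exact ⟨η, h1, h2, h4, fun X hX hDX => h3 X ⟨hX, hDX⟩⟩

/-- Any smooth field of quaternionic Hermitian matrices commutes with the base point somewhere
on the orbit of `K` under the maximal compact subgroup. -/
theorem exists_mem_unitaryOrbit_commute (A : hermQuat p q → hermQuat p q) (hA : ContDiff ℝ 3 A) :
    ∃ X : hermQuat p q, X.1 ∈ unitaryOrbit p q ∧ X.1 * (A X).1 = (A X).1 * X.1 := by
  by_contra! hno
  set A₀ : hermQuat p q := ⟨realDiag coordLabel, realDiag_mem _⟩ with hA₀
  set path : ℝ × hermQuat p q → hermQuat p q := fun z => (1 - z.1) • A₀ + z.1 • A z.2 with hpath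
  have hpathS : ContDiff ℝ 3 path :=
    ((contDiff_const.sub contDiff_fst).smul contDiff_const).add
      (contDiff_fst.smul (hA.comp contDiff_snd))
  have hpathV : ContDiff ℝ 3 fun z => (path z).1 := (hermQuat p q).subtypeL.contDiff.comp hpathS
  have hsndV : ContDiff ℝ 3 fun z : ℝ × hermQuat p q => z.2.1 :=
    (hermQuat p q).subtypeL.contDiff.comp contDiff_snd
  set Φ : ℝ × hermQuat p q → hermQuat p q :=
    fun z => ⟨commPotential z.2.1 (path z).1, commPotential_mem z.2.2 (path z).2⟩ with hΦdef
  have hΦV : ContDiff ℝ 3 fun z => (Φ z).1 := by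
    change ContDiff ℝ 3 fun z : ℝ × hermQuat p q => z.2.1 * z.2.1 +
      (z.2.1 * z.2.1 * (path z).1 - (2 : ℝ) • (z.2.1 * (path z).1 * z.2.1)
        + (path z).1 * z.2.1 * z.2.1)
    exact (hsndV.mul hsndV).add ((((hsndV.mul hsndV).mul hpathV).sub
      (ContDiff.const_smul (2 : ℝ) ((hsndV.mul hpathV).mul hsndV))).add ((hpathV.mul hsndV).mul hsndV))
  have hΦ : ContDiff ℝ 3 Φ := ContDiff.of_coe_submodule _ hΦV
  have hval : ContDiff ℝ 3 fun X : hermQuat p q => ‖X.1 - 1‖ ^ 2 :=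
    ContDiff.frobenius_norm_sq ((hermQuat p q).subtypeL.contDiff.sub contDiff_const)
  set dist1 : hermQuat p q → ℝ := fun X => ‖X.1 - 1‖ ^ 2 with hdist1
  have hFc : Continuous fun z => dist1 (Φ z) := hval.continuous.comp hΦ.continuous
  set T := {X : hermQuat p q | ‖X.1 * X.1 - 1‖ ^ 2 ≤ 1} with hT
  have hTc : IsCompact T := isCompact_norm_mul_self_sub_one_le
  have hle : ∀ t X, ‖X.1 * X.1 - 1‖ ^ 2 ≤ dist1 (Φ (t, X)) := fun t X =>
    norm_mul_self_sub_one_le X.2.1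
  have hone : ∀ t (X : hermQuat p q), dist1 (Φ (t, X)) = 0 →
      X.1 * X.1 = 1 ∧ X.1 * (path (t, X)).1 = (path (t, X)).1 * X.1 := by
    intro t X h
    refine (commPotential_eq_one_iff X.2.1).mp ?_
    exact sub_eq_zero.mp (norm_eq_zero.mp (pow_eq_zero_iff two_ne_zero |>.mp h))
  have hpath0 : ∀ X, (path (0, X)).1 = realDiag coordLabel := by
    intro X
    simp [hpath, hA₀]
  have hpath1 : ∀ X, path (1, X) = A X := by
    intro X
    simp [hpath]
  obtain ⟨η, hη, hη0, hηone, hηzero⟩ := exists_smooth_cutoff (p := p) (q := q)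
  have hsupp : ∀ X : hermQuat p q, X ∈ tsupport η → X.1 * X.1 = 1 → X.1 ∈ unitaryOrbit p q := by
    intro X hX hXX
    by_contra h
    rw [tsupport, mem_closure_iff_frequently] at hX
    exact hX ((hηzero X hXX h).mono fun Y hY => by simpa using hY)
  have hΦ0 : ContDiff ℝ 3 fun X => Φ (0, X) := hΦ.comp (contDiff_const.prodMk contDiff_id)
  set D : hermQuat p q → ℝ := fun X =>
    (-1 : ℝ) ^ q * (fderiv ℝ (fun Y => Φ (0, Y)) X).det with hD
  have hDc : Continuous D :=
    continuous_const.mul (ContinuousLinearMap.continuous_det.comp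
      (hΦ0.continuous_fderiv (by norm_num)))
  have hDpos : ∀ X : hermQuat p q, X.1 ∈ unitaryOrbit p q →
      X.1 * realDiag coordLabel = realDiag coordLabel * X.1 → 0 < D X := by
    intro X hX hXc
    obtain ⟨d, hd1, hd2, hd3⟩ := eq_realDiag_of_commute X.2 (unitaryOrbit_mul_self hX) hXc
      (trace_of_mem_unitaryOrbit hX)
    refine det_fderiv_commPotential_pos (fun Y => Φ (0, Y)) ?_ (hΦ0.differentiable (by norm_num)) X
      hd1 hd2 hd3
    intro Y
    change commPotential Y.1 (path (0, Y)).1 = _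
    rw [hpath0]
  have hnn : ∀ X, 0 ≤ dist1 X := fun X => by positivity
  -- compactness constants
  obtain ⟨ε₁, hε₁, h₁⟩ := IsCompact.exists_pos_forall_le
    (T := T ∩ {X | ¬ ∀ᶠ Y in 𝓝 X, η Y = η X})
    (hTc.inter_right (by
      rw [← isOpen_compl_iff, isOpen_iff_mem_nhds]
      intro X hX
      have hX' : ∀ᶠ Y in 𝓝 X, η Y = η X := not_not.mp hX
      filter_upwards [hX'.eventually_nhds] with Y hY
      refine not_not.mpr ?_
      have := hY.self_of_nhds
      filter_upwards [hY] with Z hZ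
      rw [hZ, this]))
    (f := fun X => ‖X.1 * X.1 - 1‖ ^ 2) (by fun_prop) (by
      rintro X ⟨-, hX⟩
      refine lt_of_le_of_ne (by positivity) fun h => hX ?_
      have hXX : X.1 * X.1 = 1 :=
        sub_eq_zero.mp (norm_eq_zero.mp (pow_eq_zero_iff two_ne_zero |>.mp h.symm))
      by_cases hG : X.1 ∈ unitaryOrbit p q
      · have h1 := hηone X hG
        rw [h1.self_of_nhds]; exact h1
      · have h1 := hηzero X hXX hG
        rw [h1.self_of_nhds]; exact h1)
  obtain ⟨ε₂, hε₂, h₂⟩ := IsCompact.exists_pos_forall_le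
    (T := T ∩ tsupport η) (hTc.inter_right (isClosed_tsupport η))
    (f := fun X => dist1 (Φ (1, X))) (hFc.comp (by fun_prop)) (by
      rintro X ⟨-, hX⟩
      refine lt_of_le_of_ne (hnn _) fun h => ?_
      obtain ⟨hXX, hXc⟩ := hone 1 X h.symm
      rw [hpath1] at hXc
      exact hno X (hsupp X hX hXX) hXc)
  obtain ⟨ε₃, hε₃, h₃⟩ := IsCompact.exists_pos_forall_le
    (T := T ∩ (tsupport η ∩ {X | D X ≤ 0}))
    (hTc.inter_right ((isClosed_tsupport η).inter (isClosed_le hDc continuous_const)))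
    (f := fun X => dist1 (Φ (0, X))) (hFc.comp (by fun_prop)) (by
      rintro X ⟨-, hX, hX'⟩
      refine lt_of_le_of_ne (hnn _) fun h => ?_
      obtain ⟨hXX, hXc⟩ := hone 0 X h.symm
      rw [hpath0] at hXc
      exact absurd (hDpos X (hsupp X hX hXX) hXc) (not_lt.mpr hX'))
  obtain ⟨ε, hε, hε'⟩ : ∃ ε > 0, ε < min (min 1 ε₁) (min ε₂ ε₃) := exists_between
    (lt_min (lt_min one_pos hε₁) (lt_min hε₂ hε₃))
  simp only [lt_min_iff] at hε'
  obtain ⟨⟨hεa, hεb⟩, hεc, hεd⟩ := hε'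
  set g : hermQuat p q → ℝ := fun Y => Real.smoothTransition (1 - dist1 Y / ε) with hg
  have hgS : ContDiff ℝ 3 g :=
    Real.smoothTransition.contDiff.comp (contDiff_const.sub (hval.div_const ε))
  have hg0 : ∀ Y, ε ≤ dist1 Y → g Y = 0 := by
    intro Y hY
    refine Real.smoothTransition.zero_of_nonpos ?_
    have : 1 ≤ dist1 Y / ε := (one_le_div hε).mpr hY
    linarith
  have hgT : ∀ t X, X ∉ T → g (Φ (t, X)) = 0 := by
    intro t X hX
    have hX' : 1 < ‖X.1 * X.1 - 1‖ ^ 2 := not_le.mp hX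
    exact hg0 _ (by linarith [hle t X])
  obtain ⟨R, hR⟩ := hTc.isBounded.subset_ball 0
  have key := degree_integrand_eq_zero Φ hΦ g η hgS hη R ?_ ?_ ?_ ((-1 : ℝ) ^ q) (by positivity)
    ?_ ⟨KQ p q, unitaryOrbit_mem_hermQuat KQ_mem_unitaryOrbit⟩
  · set X₀ : hermQuat p q := ⟨KQ p q, unitaryOrbit_mem_hermQuat KQ_mem_unitaryOrbit⟩
    have hKc : X₀.1 * realDiag coordLabel = realDiag coordLabel * X₀.1 := by
      change KQ p q * _ = _ * KQ p q
      rw [KQ, realDiag, diagonal_mul_diagonal, diagonal_mul_diagonal]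
      congr 1
      funext i
      exact mul_comm _ _
    have hpos := hDpos X₀ KQ_mem_unitaryOrbit hKc
    have h1 : η X₀ = 1 := (hηone X₀ KQ_mem_unitaryOrbit).self_of_nhds
    have h2 : dist1 (Φ (0, X₀)) = 0 := by
      have : commPotential X₀.1 (path (0, X₀)).1 = 1 := by
        rw [hpath0]
        exact (commPotential_eq_one_iff X₀.2.1).mpr ⟨KQ_mul_self, hKc⟩
      change ‖commPotential X₀.1 (path (0, X₀)).1 - 1‖ ^ 2 = 0
      rw [this, sub_self, norm_zero]; norm_num
    have h3 : g (Φ (0, X₀)) = 1 := by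
      simp only [hg, h2]
      simp
    rw [h1, h3, one_mul, one_mul] at key
    exact hpos.ne' ((congrArg (fun t => (-1 : ℝ) ^ q * t) key).trans (mul_zero _))
  · intro t X hX
    refine hgT t X fun hXT => ?_
    have := hR hXT
    rw [mem_ball_zero_iff] at this
    linarith
  · intro t X
    by_cases hX : ∀ᶠ Y in 𝓝 X, η Y = η X
    · exact Or.inl hX
    · right
      have hlt : ε < dist1 (Φ (t, X)) := by
        refine lt_of_lt_of_le ?_ (hle t X)
        by_cases hXT : X ∈ T
        · exact hεb.trans_le (h₁ X ⟨hXT, hX⟩)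
        · exact hεa.trans (not_le.mp hXT)
      filter_upwards [hFc.continuousAt.eventually_const_lt hlt] with z hz
      exact hg0 _ hz.le
  · intro X
    by_cases hXT : X ∈ T
    · by_cases hX : X ∈ tsupport η
      · rw [hg0 _ (hεc.le.trans (h₂ X ⟨hXT, hX⟩)), mul_zero]
      · rw [image_eq_zero_of_notMem_tsupport hX, zero_mul]
    · rw [hgT _ _ hXT, mul_zero]
  · intro X
    by_cases hXT : X ∈ T
    · by_cases hX : X ∈ tsupport η
      · by_cases hDX : D X ≤ 0
        · rw [hg0 _ (hεd.le.trans (h₃ X ⟨hXT, hX, hDX⟩))]; simp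
        · have h1 : 0 ≤ η X * g (Φ (0, X)) := mul_nonneg (hη0 X) (Real.smoothTransition.nonneg _)
          exact (mul_nonneg h1 (not_le.mp hDX).le).trans_eq (mul_left_comm _ _ _)
      · rw [image_eq_zero_of_notMem_tsupport hX]; simp
    · rw [hgT _ _ hXT]; simp

end CommutingPoint

section MatrixModel
variable {p q : ℕ}

namespace SLH

/-- The matrix underlying an element of `SLH p q`. -/
def mat (g : SLH p q) : Matrix (QIdx p q) (QIdx p q) ℂ := g.val.val

/-- The element of `SLH p q` with a given underlying matrix. -/
def ofMat (M : Matrix (QIdx p q) (QIdx p q) ℂ) (hd : M.det = 1) (hM : IsQuat M) : SLH p q :=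
  ⟨⟨M, M.adjugate, by rw [mul_adjugate, hd, one_smul], by rw [adjugate_mul, hd, one_smul]⟩,
    hd, isQuat_iff.mp hM⟩

@[simp] theorem mat_ofMat (M : Matrix (QIdx p q) (QIdx p q) ℂ) (hd : M.det = 1) (hM : IsQuat M) :
    (mat (ofMat M hd hM)) = M := rfl

theorem mat_det (g : SLH p q) : (mat g).det = 1 := g.2.1

theorem mat_isQuat (g : SLH p q) : IsQuat (mat g) := isQuat_iff.mpr g.2.2

@[simp] theorem mat_one : (mat (1 : SLH p q)) = 1 := rfl

@[simp] theorem mat_mul (g h : SLH p q) : (mat (g * h)) = (mat g) * (mat h) := rfl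

@[simp] theorem mat_mul_inv (g : SLH p q) : (mat g) * (mat (g⁻¹)) = 1 := by
  rw [← mat_mul, mul_inv_cancel, mat_one]

@[simp] theorem mat_inv_mul (g : SLH p q) : (mat (g⁻¹)) * (mat g) = 1 := by
  rw [← mat_mul, inv_mul_cancel, mat_one]

/-- The action `g X g*` of `SLH p q` on Hermitian forms. -/
def act (g : SLH p q) (X : Matrix (QIdx p q) (QIdx p q) ℂ) : Matrix (QIdx p q) (QIdx p q) ℂ :=
  (mat g) * X * (mat g)ᴴ

theorem act_mul (g h : SLH p q) (X : Matrix (QIdx p q) (QIdx p q) ℂ) :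
    act (g * h) X = act g (act h X) := by
  simp only [act, mat_mul, conjTranspose_mul, Matrix.mul_assoc]

@[simp] theorem act_one (X : Matrix (QIdx p q) (QIdx p q) ℂ) : act (1 : SLH p q) X = X := by
  simp [act]

@[simp] theorem act_inv_act (g : SLH p q) (X : Matrix (QIdx p q) (QIdx p q) ℂ) :
    act (g⁻¹) (act g X) = X := by
  rw [← act_mul, inv_mul_cancel, act_one]

theorem act_mem (g : SLH p q) {X : Matrix (QIdx p q) (QIdx p q) ℂ} (hX : X ∈ hermQuat p q) :
    act g X ∈ hermQuat p q := by
  refine ⟨?_, ((mat_isQuat g).mul hX.2).mul (mat_isQuat g).conjTranspose⟩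
  simp only [act, conjTranspose_mul, conjTranspose_conjTranspose, hX.1, Matrix.mul_assoc]

/-- The `SLH p q`-orbit of `K`, a model of the homogeneous space `SLH p q / Sp(p,q)`. -/
def orbit (p q : ℕ) : Set (Matrix (QIdx p q) (QIdx p q) ℂ) :=
  {X | ∃ g : SLH p q, act g (KQ p q) = X}

theorem KQ_mem_hermQuat : KQ p q ∈ hermQuat p q := ⟨KQ_conjTranspose, KQ_isQuat⟩

theorem orbit_mem_hermQuat {X : Matrix (QIdx p q) (QIdx p q) ℂ} (hX : X ∈ orbit p q) :
    X ∈ hermQuat p q := by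
  obtain ⟨g, rfl⟩ := hX
  exact (act_mem g) KQ_mem_hermQuat

theorem act_mem_orbit (g : SLH p q) {X : Matrix (QIdx p q) (QIdx p q) ℂ} (hX : X ∈ orbit p q) :
    act g X ∈ orbit p q := by
  obtain ⟨h, rfl⟩ := hX
  exact ⟨g * h, act_mul g h _⟩

theorem unitaryOrbit_subset_orbit : unitaryOrbit p q ⊆ orbit p q := by
  rintro X ⟨u, -, h2, h3, rfl⟩
  exact ⟨ofMat u h3 h2, rfl⟩

theorem mul_KQ_mul_conjTranspose_eq_iff {h : Matrix (QIdx p q) (QIdx p q) ℂ} :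
    h * KQ p q * hᴴ = KQ p q ↔ hᴴ * KQ p q * h = KQ p q := by
  have key : ∀ a b : Matrix (QIdx p q) (QIdx p q) ℂ, a * KQ p q * b = KQ p q →
      b * KQ p q * a = KQ p q := by
    intro a b hab
    have h1 : a * (KQ p q * b * KQ p q) = 1 := by
      rw [← Matrix.mul_assoc, ← Matrix.mul_assoc, hab, KQ_mul_self]
    have h2 := mul_eq_one_comm.mp h1
    calc b * KQ p q * a = KQ p q * (KQ p q * b * KQ p q * a) := by
          simp only [← Matrix.mul_assoc, KQ_mul_self, Matrix.one_mul]
      _ = KQ p q := by rw [h2, Matrix.mul_one]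
  exact ⟨key _ _, key _ _⟩

theorem mem_SpPQ_iff {g : SLH p q} : g ∈ SpPQinSLH p q ↔ act g (KQ p q) = KQ p q :=
  mul_KQ_mul_conjTranspose_eq_iff.symm

theorem mk_eq_mk_iff {g h : SLH p q} :
    (QuotientGroup.mk g : SLH p q ⧸ SpPQinSLH p q) = QuotientGroup.mk h ↔
      act g (KQ p q) = act h (KQ p q) := by
  rw [QuotientGroup.eq, mem_SpPQ_iff, act_mul]
  constructor
  · intro hk
    have := congrArg (act g) hk
    rw [← act_mul, mul_inv_cancel, act_one] at this
    exact this.symm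
  · intro hk
    rw [← hk, act_inv_act]

section Norm
open scoped Matrix.Norms.Frobenius

theorem norm_act_le (g : SLH p q) (X : Matrix (QIdx p q) (QIdx p q) ℂ) :
    ‖act g X‖ ≤ ‖(mat g)‖ ^ 2 * ‖X‖ := by
  calc ‖act g X‖ ≤ ‖(mat g) * X‖ * ‖(mat g)ᴴ‖ := norm_mul_le _ _
    _ ≤ ‖(mat g)‖ * ‖X‖ * ‖(mat g)ᴴ‖ := by gcongr; exact norm_mul_le _ _
    _ = _ := by rw [Matrix.frobenius_norm_conjTranspose]; ring

theorem exists_act_eq_norm_le {X : Matrix (QIdx p q) (QIdx p q) ℂ} (hX : X ∈ orbit p q) :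
    ∃ b : SLH p q, act b (KQ p q) = X ∧
      2 * ‖(mat b)‖ ^ 2 ≤ ‖(1 : Matrix (QIdx p q) (QIdx p q) ℂ)‖ ^ 2 + ‖X‖ ^ 2 := by
  obtain ⟨g, hg⟩ := hX
  obtain ⟨h, P, h1, h2, h3, h4, h5, h6⟩ :=
    exists_stabilizer_mul_conjTranspose (mat_isQuat g) (mat_det g) hg
  have hXh : Xᴴ = X := (orbit_mem_hermQuat ⟨g, hg⟩).1
  refine ⟨g * ofMat h h2 h1, ?_, ?_⟩
  · rw [act_mul, show act (ofMat h h2 h1) (KQ p q) = KQ p q from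
      mul_KQ_mul_conjTranspose_eq_iff.mpr h3, hg]
  · have hP : Pᴴ = P := by rw [← h6]; simp
    have h7 : ‖(mat (g * ofMat h h2 h1))‖ ^ 2 = P.trace.re := by
      rw [frobenius_norm_sq, Matrix.trace_mul_comm, mat_mul, mat_ofMat, h6]
    have h8 : ‖P - 1‖ ^ 2 = ‖X‖ ^ 2 - 2 * P.trace.re +
        ‖(1 : Matrix (QIdx p q) (QIdx p q) ℂ)‖ ^ 2 := by
      rw [frobenius_norm_sq, frobenius_norm_sq, frobenius_norm_sq, hXh, ← h5]
      simp [hP, sub_mul, mul_sub]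
      ring
    rw [h7]
    nlinarith [sq_nonneg (‖P - 1‖)]

end Norm

end SLH

end MatrixModel

section TraceBound
open scoped ComplexOrder

theorem two_mul_trace_re_le {ι : Type*} [Fintype ι] [DecidableEq ι] {N Z Q : Matrix ι ι ℂ}
    (hN : N.PosSemidef) (hZ : Zᴴ = Z) (hQ : Qᴴ = Q)
    (hZQ : Z * (1 + N)⁻¹ * Z = Q * (1 + N)⁻¹ * Q) :
    2 * Z.trace.re ≤ (1 + N).trace.re + (Q * Q).trace.re := by
  have hB : (1 + N).PosDef := Matrix.PosDef.one.add_posSemidef hN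
  have hC : (1 + N)⁻¹.PosDef := hB.inv
  have hdet : IsUnit (1 + N).det := (Matrix.isUnit_iff_isUnit_det _).mp hB.isUnit
  have hBh : (1 + N)ᴴ = 1 + N := hB.isHermitian
  set B := 1 + N with hBdef
  have hCB : B⁻¹ * B = 1 := nonsing_inv_mul _ hdet
  have hBC : B * B⁻¹ = 1 := mul_nonsing_inv _ hdet
  have hCh : (B⁻¹)ᴴ = B⁻¹ := hC.isHermitian
  have h1 : 0 ≤ ((B - Z) * B⁻¹ * (B - Z)ᴴ).trace.re :=
    (Complex.le_def.mp (hC.posSemidef.mul_mul_conjTranspose_same (B - Z)).trace_nonneg).1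
  have e1 : (B - Z) * B⁻¹ * (B - Z)ᴴ = B - Z - Z + Q * B⁻¹ * Q := by
    rw [conjTranspose_sub, hBh, hZ, ← hZQ, sub_mul, hBC, sub_mul, mul_sub, mul_sub, Matrix.one_mul,
      Matrix.one_mul, Matrix.mul_assoc Z _ B, hCB, Matrix.mul_one]
    abel
  have hpsd : (1 - B⁻¹).PosSemidef := by
    have e2 : 1 - B⁻¹ = B⁻¹ * (N + Nᴴ * N) * (B⁻¹)ᴴ := by
      rw [hCh, hN.isHermitian.eq]
      have : N + N * N = B * B - B := by rw [hBdef]; noncomm_ring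
      rw [this, mul_sub, ← Matrix.mul_assoc, hCB, Matrix.one_mul, sub_mul, hBC, Matrix.one_mul]
    rw [e2]
    exact (hN.add (posSemidef_conjTranspose_mul_self N)).mul_mul_conjTranspose_same _
  have h2 : 0 ≤ (Q * (1 - B⁻¹) * Qᴴ).trace.re :=
    (Complex.le_def.mp (hpsd.mul_mul_conjTranspose_same Q).trace_nonneg).1
  rw [e1] at h1
  rw [hQ, mul_sub, sub_mul, Matrix.mul_one] at h2
  simp only [trace_add, trace_sub, Complex.add_re, Complex.sub_re] at h1 h2
  linarith

end TraceBound

section ReducedNorm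
open scoped ComplexOrder Matrix.Norms.Frobenius
variable {p q : ℕ}
namespace SLH

/-- The positive matrix `(γ* γ)⁻¹`. -/
def weight (γ : SLH p q) : Matrix (QIdx p q) (QIdx p q) ℂ := mat (γ⁻¹) * (mat (γ⁻¹))ᴴ

theorem weight_posSemidef (γ : SLH p q) : (weight γ).PosSemidef :=
  posSemidef_self_mul_conjTranspose _

theorem weight_mem (γ : SLH p q) : weight γ ∈ hermQuat p q :=
  ⟨(weight_posSemidef γ).isHermitian, (mat_isQuat _).mul (mat_isQuat _).conjTranspose⟩

theorem act_weight (h γ : SLH p q) : act h (weight γ) = weight (γ * h⁻¹) := by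
  simp only [act, weight, _root_.mul_inv_rev, inv_inv, mat_mul, conjTranspose_mul,
    Matrix.mul_assoc]

theorem weight_one : weight (1 : SLH p q) = 1 := by simp [weight]

/-- If `Γ` acts properly with bounded fundamental domain on the orbit of `K`, then each coset
`Γ g` contains an element of bounded norm. -/
theorem exists_mul_norm_le (Γ : Subgroup (SLH p q))
    (hF : ∀ ρ : ℝ, {γ : SLH p q | γ ∈ Γ ∧ ∃ X ∈ orbit p q, ‖X‖ ^ 2 ≤ ρ ∧ ‖act γ X‖ ^ 2 ≤ ρ}.Finite)
    (hC : ∃ ρ : ℝ, ∀ X ∈ orbit p q, ∃ γ ∈ Γ, ‖act γ X‖ ^ 2 ≤ ρ) :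
    ∃ c : ℝ, ∀ g : SLH p q, ∃ γ ∈ Γ, ‖mat (γ * g)‖ ^ 2 ≤ c := by
  classical
  obtain ⟨ρ, hρ⟩ := hC
  set ψ : Matrix (QIdx p q) (QIdx p q) ℂ → ℝ :=
    fun X => Real.smoothTransition (ρ + 1 - ‖X‖ ^ 2) with hψ
  have hψ0 : ∀ X, 0 ≤ ψ X := fun X => Real.smoothTransition.nonneg _
  have hψ1 : ∀ X, ψ X ≤ 1 := fun X => Real.smoothTransition.le_one _
  have hψone : ∀ X, ‖X‖ ^ 2 ≤ ρ → ψ X = 1 := fun X hX =>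
    Real.smoothTransition.one_of_one_le (by linarith)
  have hψne : ∀ X, ψ X ≠ 0 → ‖X‖ ^ 2 ≤ ρ + 1 := by
    intro X hX
    by_contra h
    exact hX (Real.smoothTransition.zero_of_nonpos (by linarith [not_le.mp h]))
  set F := (hF (ρ + 1)).toFinset with hFdef
  refine ⟨(∑ γ ∈ F, (weight γ).trace.re + ρ) / 2, fun g => ?_⟩
  have hS : {γ : SLH p q | γ ∈ Γ ∧ ∃ X ∈ unitaryOrbit p q,
      ‖act (γ * g) X‖ ^ 2 ≤ ρ + 1}.Finite := by
    obtain ⟨r, hr⟩ := (isCompact_unitaryOrbit (p := p) (q := q)).exists_bound_of_continuousOn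
      (f := fun X => act g X) (by unfold act; fun_prop)
    refine (hF (max (r ^ 2) (ρ + 1))).subset ?_
    rintro γ ⟨hγ, X, hX, hX'⟩
    refine ⟨hγ, act g X, act_mem_orbit g (unitaryOrbit_subset_orbit hX), ?_, ?_⟩
    · exact le_max_of_le_left (pow_le_pow_left₀ (norm_nonneg _) (hr X hX) 2)
    · rw [← act_mul]
      exact le_max_of_le_right hX'
  set S := hS.toFinset with hSdef
  set A : hermQuat p q → hermQuat p q := fun X =>
    ∑ γ ∈ S, ψ (act (γ * g) X.1) • ⟨weight (γ * g), weight_mem _⟩ with hA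
  have hAS : ContDiff ℝ 3 A := by
    refine ContDiff.sum fun γ _ => ?_
    have hψγ : ContDiff ℝ 3 fun X : hermQuat p q => ψ (act (γ * g) X.1) := by
      refine Real.smoothTransition.contDiff.comp (contDiff_const.sub
        (ContDiff.frobenius_norm_sq ?_))
      unfold act
      exact (contDiff_const.mul ((hermQuat p q).subtypeL.contDiff)).mul contDiff_const
    exact hψγ.smul (contDiff_const (c := (⟨weight (γ * g), weight_mem _⟩ : hermQuat p q)))
  obtain ⟨X, hX, hXA⟩ := exists_mem_unitaryOrbit_commute A hAS
  have hXX := unitaryOrbit_mul_self hX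
  set P := (A X).1 with hP
  have hPsum : P = ∑ γ ∈ S, ψ (act (γ * g) X.1) • weight (γ * g) := by
    rw [hP, hA]
    simp
  obtain ⟨γ₀, hγ₀, hγ₀'⟩ := hρ (act g X.1) (act_mem_orbit g (unitaryOrbit_subset_orbit hX))
  rw [← act_mul] at hγ₀'
  refine ⟨γ₀, hγ₀, ?_⟩
  set h := γ₀ * g with hh
  set Q := act h X.1 with hQ
  have hQo : Q ∈ orbit p q := act_mem_orbit _ (unitaryOrbit_subset_orbit hX)
  have hQh : Qᴴ = Q := (orbit_mem_hermQuat hQo).1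
  have hB : act h P = ∑ γ ∈ F, ψ (act γ Q) • weight γ := by
    have h1 : act h P = ∑ γ ∈ S, ψ (act (γ * γ₀⁻¹) Q) • weight (γ * γ₀⁻¹) := by
      rw [hPsum, act, Finset.mul_sum, Finset.sum_mul]
      refine Finset.sum_congr rfl fun γ _ => ?_
      rw [Matrix.mul_smul, Matrix.smul_mul]
      change _ • act h (weight (γ * g)) = _
      rw [act_weight, hQ, ← act_mul, hh]
      rw [show γ * γ₀⁻¹ * (γ₀ * g) = γ * g by group, show γ * g * (γ₀ * g)⁻¹ = γ * γ₀⁻¹ by group]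
    rw [h1]
    refine Finset.sum_bij_ne_zero (fun γ _ _ => γ * γ₀⁻¹) ?_ ?_ ?_ ?_
    · intro γ hγ hne
      rw [hSdef, Set.Finite.mem_toFinset] at hγ
      rw [hFdef, Set.Finite.mem_toFinset]
      exact ⟨Γ.mul_mem hγ.1 (Γ.inv_mem hγ₀), Q, hQo, by linarith,
        hψne _ (left_ne_zero_of_smul hne)⟩
    · intro a _ _ b _ _ hab
      exact mul_right_cancel hab
    · intro γ hγ hne
      rw [hFdef, Set.Finite.mem_toFinset] at hγ
      refine ⟨γ * γ₀, ?_, ?_, by group⟩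
      · rw [hSdef, Set.Finite.mem_toFinset]
        refine ⟨Γ.mul_mem hγ.1 hγ₀, X.1, hX, ?_⟩
        rw [mul_assoc, act_mul]
        exact hψne _ (left_ne_zero_of_smul hne)
      · simpa using hne
    · intro γ _ _
      rfl
  have h1F : (1 : SLH p q) ∈ F := by
    rw [hFdef, Set.Finite.mem_toFinset]
    exact ⟨Γ.one_mem, Q, hQo, by linarith, by rw [act_one]; linarith⟩
  set N := ∑ γ ∈ F.erase 1, ψ (act γ Q) • weight γ with hN
  have hNpsd : N.PosSemidef :=
    Matrix.posSemidef_sum _ fun γ _ => (weight_posSemidef γ).smul (hψ0 _)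
  have hBN : act h P = 1 + N := by
    rw [hB, ← Finset.add_sum_erase _ _ h1F, act_one, weight_one, hψone Q hγ₀', one_smul]
  have hBtr : (1 + N).trace.re ≤ ∑ γ ∈ F, (weight γ).trace.re := by
    rw [← hBN, hB, trace_sum, Complex.re_sum]
    refine Finset.sum_le_sum fun γ _ => ?_
    rw [trace_smul, Complex.real_smul, Complex.re_ofReal_mul]
    have : 0 ≤ (weight γ).trace.re := (Complex.le_def.mp (weight_posSemidef γ).trace_nonneg).1
    exact mul_le_of_le_one_left this (hψ1 _)
  have hdet : IsUnit (1 + N).det := (Matrix.isUnit_iff_isUnit_det _).mp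
    (Matrix.PosDef.one.add_posSemidef hNpsd).isUnit
  set M := mat h with hM
  set M' := mat (h⁻¹) with hM'
  have hMM' : M * M' = 1 := mat_mul_inv h
  have hM'M : M' * M = 1 := mat_inv_mul h
  have hMM'h : M'ᴴ * Mᴴ = 1 := by rw [← conjTranspose_mul, hMM', conjTranspose_one]
  have hM'Mh : Mᴴ * M'ᴴ = 1 := by rw [← conjTranspose_mul, hM'M, conjTranspose_one]
  have hBC : (M * P * Mᴴ) * (1 + N)⁻¹ = 1 := by
    change act h P * _ = 1
    rw [hBN, mul_nonsing_inv _ hdet]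
  set C := (1 + N)⁻¹ with hCdef
  -- the inverse of `P` is `M* C M`
  have hPE : P * (Mᴴ * C * M) = 1 := by
    calc P * (Mᴴ * C * M) = (M' * M) * P * (Mᴴ * C * M) := by rw [hM'M, Matrix.one_mul]
      _ = M' * ((M * P * Mᴴ) * C) * M := by simp only [Matrix.mul_assoc]
      _ = 1 := by rw [hBC, Matrix.mul_one, hM'M]
  have hEP := mul_eq_one_comm.mp hPE
  have hXE : X.1 * (Mᴴ * C * M) * X.1 = Mᴴ * C * M := by
    calc X.1 * (Mᴴ * C * M) * X.1
        = (Mᴴ * C * M * P) * X.1 * (Mᴴ * C * M) * X.1 := by rw [hEP, Matrix.one_mul]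
      _ = Mᴴ * C * M * (P * X.1) * (Mᴴ * C * M) * X.1 := by simp only [Matrix.mul_assoc]
      _ = Mᴴ * C * M * (X.1 * (P * (Mᴴ * C * M)) * X.1) := by
        rw [← hXA]; simp only [Matrix.mul_assoc]
      _ = Mᴴ * C * M := by rw [hPE, Matrix.mul_one, hXX, Matrix.mul_one]
  have hZQ : (M * Mᴴ) * C * (M * Mᴴ) = Q * C * Q := by
    calc (M * Mᴴ) * C * (M * Mᴴ) = M * (Mᴴ * C * M) * Mᴴ := by simp only [Matrix.mul_assoc]
      _ = M * (X.1 * (Mᴴ * C * M) * X.1) * Mᴴ := by rw [hXE]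
      _ = (M * X.1 * Mᴴ) * C * (M * X.1 * Mᴴ) := by simp only [Matrix.mul_assoc]
  have key := two_mul_trace_re_le hNpsd (by simp) hQh hZQ
  have h3 : ‖M‖ ^ 2 = (M * Mᴴ).trace.re := by
    rw [frobenius_norm_sq, Matrix.trace_mul_comm]
  have h4 : (Q * Q).trace.re ≤ ρ := by
    have := frobenius_norm_sq Q
    rw [hQh] at this
    rw [← this]; exact hγ₀'
  rw [h3]
  linarith

end SLH
end ReducedNorm

section Unbounded
open scoped Matrix.Norms.Frobenius
variable {p q : ℕ}

theorem norm_entry_le_frobenius {ι : Type*} [Fintype ι] (M : Matrix ι ι ℂ) (i j : ι) :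
    ‖M i j‖ ≤ ‖M‖ := by
  refine (sq_le_sq₀ (norm_nonneg _) (norm_nonneg _)).mp ?_
  rw [Matrix.frobenius_norm_def, ← Real.sqrt_eq_rpow, Real.sq_sqrt (by positivity)]
  simp only [Real.rpow_ofNat]
  calc ‖M i j‖ ^ 2 ≤ ∑ j, ‖M i j‖ ^ 2 :=
        Finset.single_le_sum (f := fun j => ‖M i j‖ ^ 2) (fun _ _ => by positivity)
          (Finset.mem_univ j)
    _ ≤ _ := Finset.single_le_sum (f := fun i => ∑ j, ‖M i j‖ ^ 2) (fun _ _ => by positivity)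
          (Finset.mem_univ i)

/-- The swap of the coordinates `i` and `j`, as a self-adjoint partial isometry. -/
def partialSwap (i : Fin p) (j : Fin q) : Matrix (QIdx p q) (QIdx p q) ℂ :=
  Matrix.fromBlocks
    (Matrix.single (Sum.inl i) (Sum.inr j) 1 + Matrix.single (Sum.inr j) (Sum.inl i) 1) 0 0
    (Matrix.single (Sum.inl i) (Sum.inr j) 1 + Matrix.single (Sum.inr j) (Sum.inl i) 1)

theorem partialSwap_conjTranspose (i : Fin p) (j : Fin q) :
    (partialSwap i j)ᴴ = partialSwap i j := by
  simp [partialSwap, Matrix.fromBlocks_conjTranspose, add_comm]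

theorem partialSwap_isQuat (i : Fin p) (j : Fin q) : IsQuat (partialSwap i j) := by
  rw [isQuat_iff_entries]
  intro a b
  simp only [partialSwap, Matrix.fromBlocks_apply₁₁, Matrix.fromBlocks_apply₂₂,
    Matrix.fromBlocks_apply₂₁, Matrix.fromBlocks_apply₁₂, Matrix.add_apply, Matrix.single_apply,
    Matrix.zero_apply, star_zero, neg_zero, and_true]
  split_ifs <;> simp

theorem partialSwap_mul_self (i : Fin p) (j : Fin q) :
    partialSwap i j * partialSwap i j = Matrix.fromBlocks
    (Matrix.single (Sum.inl i) (Sum.inl i) 1 + Matrix.single (Sum.inr j) (Sum.inr j) 1) 0 0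
    (Matrix.single (Sum.inl i) (Sum.inl i) 1 + Matrix.single (Sum.inr j) (Sum.inr j) 1) := by
  simp [partialSwap, Matrix.fromBlocks_multiply, add_mul, mul_add, add_comm]

theorem partialSwap_cube (i : Fin p) (j : Fin q) :
    partialSwap i j * (partialSwap i j * partialSwap i j) = partialSwap i j := by
  rw [partialSwap_mul_self]
  simp [partialSwap, Matrix.fromBlocks_multiply, add_mul, mul_add, add_comm]

theorem KQ_mul_partialSwap (i : Fin p) (j : Fin q) :
    KQ p q * partialSwap i j = -(partialSwap i j * KQ p q) := by
  ext a b
  rw [KQ, Matrix.diagonal_mul, Matrix.neg_apply, Matrix.mul_diagonal]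
  rcases a with (a | a) | (a | a) <;> rcases b with (b | b) | (b | b) <;>
    simp [partialSwap, Matrix.single_apply, apply_ite]

namespace SLH

theorem exists_stabilizer_le_norm (hp : 0 < p) (hq : 0 < q) {t : ℝ} (ht : 0 ≤ t) :
    ∃ h : SLH p q, act h (KQ p q) = KQ p q ∧ t ≤ ‖mat h‖ := by
  set W := partialSwap (⟨0, hp⟩ : Fin p) (⟨0, hq⟩ : Fin q) with hW
  have hWh : Wᴴ = W := partialSwap_conjTranspose _ _
  have hWq : IsQuat W := partialSwap_isQuat _ _
  have hW3 : W * (W * W) = W := partialSwap_cube _ _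
  have hKW : KQ p q * W = -(W * KQ p q) := KQ_mul_partialSwap _ _
  obtain ⟨c, hc1, hc⟩ : ∃ c : ℝ, 1 ≤ c ∧ c ^ 2 = 1 + t ^ 2 :=
    ⟨√(1 + t ^ 2), Real.one_le_sqrt.mpr (by nlinarith), Real.sq_sqrt (by positivity)⟩
  set D := W * W with hD
  have hWD : W * D = W := hW3
  have hDW : D * W = W := by rw [hD, Matrix.mul_assoc, hW3]
  have hDD : D * D = D := by nth_rw 1 [hD]; rw [Matrix.mul_assoc, hWD]
  have hDh : Dᴴ = D := by rw [hD, conjTranspose_mul, hWh]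
  have hKD : D * KQ p q = KQ p q * D := by
    rw [hD, ← Matrix.mul_assoc (KQ p q), hKW, neg_mul, Matrix.mul_assoc W (KQ p q) W, hKW,
      mul_neg, neg_neg, Matrix.mul_assoc]
  set s := 1 + (c - 1) • D + t • W with hs
  have hsh : sᴴ = s := by simp [hs, hDh, hWh]
  have hsq : IsQuat s := (IsQuat.one.add ((hWq.mul hWq).smul _)).add (hWq.smul _)
  have hsK : s * KQ p q = KQ p q * (1 + (c - 1) • D - t • W) := by
    simp only [hs, add_mul, mul_add, mul_sub, Matrix.smul_mul, Matrix.mul_smul, hKD, hKW,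
      Matrix.one_mul, Matrix.mul_one, smul_neg, sub_neg_eq_add]
  have hss' : (1 + (c - 1) • D - t • W) * s = 1 := by
    have : (1 + (c - 1) • D - t • W) * s = 1 + (c ^ 2 - 1 - t ^ 2) • D := by
      simp only [hs, add_mul, mul_add, sub_mul, Matrix.smul_mul, Matrix.mul_smul, hDD, hWD, hDW,
        ← hD, Matrix.one_mul, Matrix.mul_one, smul_smul]
      module
    rw [this, hc]
    simp
  have hsKs : s * KQ p q * s = KQ p q := by rw [hsK, Matrix.mul_assoc, hss', Matrix.mul_one]
  have hsdet : (s * s).det = 1 := by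
    have hK : (KQ p q).det ≠ 0 := fun h0 => by
      have := congrArg Matrix.det (KQ_mul_self (p := p) (q := q))
      rw [det_mul, h0, det_one, zero_mul] at this
      exact zero_ne_one this
    have := congrArg Matrix.det hsKs
    rw [det_mul, det_mul] at this
    rw [det_mul]
    exact mul_right_cancel₀ hK (by linear_combination this)
  have hss : s * s = 1 + (c ^ 2 - 1 + t ^ 2) • D + (2 * c * t) • W := by
    simp only [hs, add_mul, mul_add, Matrix.smul_mul, Matrix.mul_smul, hDD, hWD, hDW,
      ← hD, Matrix.one_mul, Matrix.mul_one, smul_smul]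
    module
  refine ⟨ofMat (s * s) hsdet (hsq.mul hsq), ?_, ?_⟩
  · rw [act, mat_ofMat, conjTranspose_mul, hsh]
    calc s * s * KQ p q * (s * s) = s * (s * KQ p q * s) * s := by simp only [Matrix.mul_assoc]
      _ = KQ p q := by rw [hsKs, hsKs]
  · refine le_trans ?_ (norm_entry_le_frobenius _ (Sum.inl (Sum.inl ⟨0, hp⟩))
      (Sum.inl (Sum.inr ⟨0, hq⟩)))
    have hentry : (s * s) (Sum.inl (Sum.inl ⟨0, hp⟩)) (Sum.inl (Sum.inr ⟨0, hq⟩)) =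
        ((2 * c * t : ℝ) : ℂ) := by
      rw [hss, hD, hW, partialSwap_mul_self]
      simp [partialSwap]
    rw [mat_ofMat, hentry, Complex.norm_real]
    exact (by nlinarith : t ≤ 2 * c * t).trans (le_abs_self _)

end SLH
end Unbounded

section Compactness
open scoped Matrix.Norms.Frobenius Topology
variable {p q : ℕ}
namespace SLH

theorem continuous_mat : Continuous (mat : SLH p q → Matrix (QIdx p q) (QIdx p q) ℂ) :=
  Units.continuous_val.comp continuous_subtype_val

theorem isCompact_setOf_norm_mat_le (R : ℝ) : IsCompact {g : SLH p q | ‖mat g‖ ≤ R} := by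
  set T : Set (Matrix (QIdx p q) (QIdx p q) ℂ) := {M | ‖M‖ ≤ R ∧ M.det = 1 ∧ IsQuat M} with hT
  have hTc : IsCompact T := by
    refine Metric.isCompact_of_isClosed_isBounded ?_ ?_
    · refine (isClosed_le continuous_norm continuous_const).inter
        (IsClosed.inter ?_ isClosed_setOf_isQuat)
      exact isClosed_eq (Continuous.matrix_det continuous_id) continuous_const
    · exact (Metric.isBounded_closedBall (x := 0) (r := R)).subset fun M hM => by simpa using hM.1
  have hcont : Continuous fun M : T => ofMat M.1 M.2.2.1 M.2.2.2 := by
    refine Continuous.subtype_mk (Units.continuous_iff.mpr ⟨continuous_subtype_val, ?_⟩) _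
    exact Continuous.matrix_adjugate continuous_subtype_val
  have := isCompact_iff_compactSpace.mp hTc
  convert isCompact_range hcont using 1
  ext g
  constructor
  · intro hg
    exact ⟨⟨mat g, hg, mat_det g, mat_isQuat g⟩, Subtype.ext (Units.ext rfl)⟩
  · rintro ⟨M, rfl⟩
    exact M.2.1

theorem exists_forall_norm_act_le (Γ : Subgroup (SLH p q))
    (h : CompactSpace (MulAction.orbitRel.Quotient Γ (SLH p q ⧸ SpPQinSLH p q))) :
    ∃ ρ : ℝ, ∀ X ∈ orbit p q, ∃ γ ∈ Γ, ‖act γ X‖ ^ 2 ≤ ρ := by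
  set f : SLH p q → MulAction.orbitRel.Quotient Γ (SLH p q ⧸ SpPQinSLH p q) :=
    fun g => Quotient.mk'' (QuotientGroup.mk g) with hf
  have hfo : IsOpenMap f :=
    have : ContinuousConstSMul Γ (SLH p q ⧸ SpPQinSLH p q) :=
      ⟨fun γ => continuous_const_smul (γ : SLH p q)⟩
    (isOpenMap_quotient_mk'_mul (Γ := Γ) (T := SLH p q ⧸ SpPQinSLH p q)).comp
      QuotientGroup.isOpenMap_coe
  have hcov := isCompact_univ.elim_directed_cover
    (fun n : ℕ => f '' {g | ‖mat g‖ < n})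
    (fun n => hfo _ (isOpen_lt (continuous_norm.comp continuous_mat) continuous_const))
    (by
      intro x _
      obtain ⟨y, rfl⟩ := Quotient.mk''_surjective x
      obtain ⟨g, rfl⟩ := QuotientGroup.mk_surjective y
      obtain ⟨n, hn⟩ := exists_nat_gt ‖mat g‖
      exact Set.mem_iUnion.mpr ⟨n, g, hn, rfl⟩)
    (Monotone.directed_le fun m n hmn => Set.image_mono fun g hg =>
      lt_of_lt_of_le (show ‖mat g‖ < m from hg) (Nat.cast_le.mpr hmn))
  obtain ⟨n, hn⟩ := hcov
  refine ⟨((n : ℝ) ^ 2 * ‖KQ p q‖) ^ 2, ?_⟩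
  rintro X ⟨g, rfl⟩
  obtain ⟨x, hx, hxg⟩ := hn (Set.mem_univ (f g))
  obtain ⟨γ, hγ⟩ := MulAction.orbitRel_apply.mp (Quotient.eq''.mp hxg)
  refine ⟨γ, γ.2, ?_⟩
  have hγ' : act (γ.1 * g) (KQ p q) = act x (KQ p q) := mk_eq_mk_iff.mp hγ
  rw [← act_mul, hγ']
  have hx' : ‖mat x‖ < n := hx
  refine pow_le_pow_left₀ (norm_nonneg _) ((norm_act_le _ _).trans ?_) 2
  gcongr

theorem finite_setOf_norm_act_le (Γ : Subgroup (SLH p q))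
    (h : ProperlyDiscontinuousSMul Γ (SLH p q ⧸ SpPQinSLH p q)) (ρ : ℝ) :
    {γ : SLH p q | γ ∈ Γ ∧ ∃ X ∈ orbit p q, ‖X‖ ^ 2 ≤ ρ ∧ ‖act γ X‖ ^ 2 ≤ ρ}.Finite := by
  set R := √(‖(1 : Matrix (QIdx p q) (QIdx p q) ℂ)‖ ^ 2 + ρ) with hR
  have key : ∀ X ∈ orbit p q, ‖X‖ ^ 2 ≤ ρ → ∃ b : SLH p q, act b (KQ p q) = X ∧ ‖mat b‖ ≤ R := by
    intro X hX hXρ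
    obtain ⟨b, hb, hb'⟩ := exists_act_eq_norm_le hX
    exact ⟨b, hb, Real.le_sqrt_of_sq_le (by nlinarith [sq_nonneg ‖mat b‖])⟩
  have hcpt : IsCompact ((QuotientGroup.mk : SLH p q → SLH p q ⧸ SpPQinSLH p q) ''
      {g | ‖mat g‖ ≤ R}) := (isCompact_setOf_norm_mat_le R).image continuous_quotient_mk'
  refine ((h.finite_disjoint_inter_image hcpt hcpt).image Subtype.val).subset ?_
  rintro γ ⟨hγ, X, hX, h1, h2⟩
  obtain ⟨b, hb, hbR⟩ := key X hX h1
  obtain ⟨c, hc, hcR⟩ := key _ (act_mem_orbit γ hX) h2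
  refine ⟨⟨γ, hγ⟩, ⟨QuotientGroup.mk c, ⟨_, ⟨b, hbR, rfl⟩, ?_⟩, ⟨c, hcR, rfl⟩⟩, rfl⟩
  change (QuotientGroup.mk (γ * b) : SLH p q ⧸ SpPQinSLH p q) = QuotientGroup.mk c
  rw [mk_eq_mk_iff, act_mul, hb, hc]

/-- A subgroup acting properly discontinuously with compact quotient on the orbit of `K` forces
the stabilizer of `K` to be bounded. -/
theorem exists_forall_stabilizer_norm_le (Γ : Subgroup (SLH p q))
    (hF : ∀ ρ : ℝ, {γ : SLH p q | γ ∈ Γ ∧ ∃ X ∈ orbit p q, ‖X‖ ^ 2 ≤ ρ ∧ ‖act γ X‖ ^ 2 ≤ ρ}.Finite)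
    (hC : ∃ ρ : ℝ, ∀ X ∈ orbit p q, ∃ γ ∈ Γ, ‖act γ X‖ ^ 2 ≤ ρ) :
    ∃ R : ℝ, ∀ h : SLH p q, act h (KQ p q) = KQ p q → ‖mat h‖ ≤ R := by
  obtain ⟨c, hc⟩ := exists_mul_norm_le Γ hF hC
  set ρ := max (‖KQ p q‖ ^ 2) ((c * ‖KQ p q‖) ^ 2) with hρ
  obtain ⟨r, hr⟩ := ((hF ρ).image fun γ => ‖mat (γ⁻¹)‖).bddAbove
  refine ⟨r * √c, fun h hh => ?_⟩
  obtain ⟨γ, hγ, hγh⟩ := hc h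
  have hmem : ‖mat (γ⁻¹)‖ ≤ r := by
    refine hr ⟨γ, ⟨hγ, KQ p q, ⟨1, act_one _⟩, le_max_left _ _, le_max_of_le_right ?_⟩, rfl⟩
    rw [← hh, ← act_mul, hh]
    refine pow_le_pow_left₀ (norm_nonneg _) ((norm_act_le _ _).trans ?_) 2
    gcongr
  calc ‖mat h‖ = ‖mat (γ⁻¹) * mat (γ * h)‖ := by rw [← mat_mul, inv_mul_cancel_left]
    _ ≤ ‖mat (γ⁻¹)‖ * ‖mat (γ * h)‖ := norm_mul_le _ _
    _ ≤ r * √c := by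
      have := Real.le_sqrt_of_sq_le hγh
      gcongr
      exact (norm_nonneg _).trans hmem

end SLH
end Compactness

/-- **No compact Clifford–Klein forms for `SL(p+q,ℍ)/Sp(p,q)`, `p, q > 1`.**
There is no discrete subgroup `Γ` of `G = SL(p+q,ℍ) = SU*(2(p+q))` acting properly
discontinuously and cocompactly on the homogeneous space `G/H`, where `H = Sp(p,q)`. -/
theorem no_compact_CliffordKlein_form_SLH_SpPQ (p q : ℕ) (hp : 1 < p) (hq : 1 < q) :
    ¬ ∃ Γ : Subgroup ↥(SLH p q), DiscreteTopology ↥Γ ∧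
      ProperlyDiscontinuousSMul ↥Γ (↥(SLH p q) ⧸ SpPQinSLH p q) ∧
      CompactSpace (MulAction.orbitRel.Quotient ↥Γ (↥(SLH p q) ⧸ SpPQinSLH p q)) := by
  rintro ⟨Γ, -, hΓ, hcpt⟩
  obtain ⟨R, hR⟩ := SLH.exists_forall_stabilizer_norm_le Γ (SLH.finite_setOf_norm_act_le Γ hΓ)
    (SLH.exists_forall_norm_act_le Γ hcpt)
  obtain ⟨h, hh, hRh⟩ := SLH.exists_stabilizer_le_norm (p := p) (q := q) (by omega) (by omega)
    (t := |R| + 1) (by positivity)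
  linarith [hR h hh, le_abs_self R]
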